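/- arXiv:2011.12029 — 7 statements merged into one kernel-verified Lean document; each statement's English description precedes it below -/
import Mathlib

section
/- Let Ω be a nonempty open connected subset of ℝⁿ and let 0 < μ₁ < μ₂ < ∞. Then there is a constant C > 0, depending only on n, μ₁ and μ₂, such that [f]_{BMO^{μ₂}(Ω)} ≤ C·[f]_{BMO^{μ₁}(Ω)} for every f ∈ L¹_loc(Ω); since trivially [f]_{BMO^{μ₁}(Ω)} ≤ [f]_{BMO^{μ₂}(Ω)}, the two seminorms are equivalent. -/
open MeasureTheory Metric ENNReal

/-- The `BMO^μ(Ω)` seminorm: supremum of mean oscillations over closed balls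
contained in `Ω` of radius `r < μ`. -/
noncomputable def bmoSemi {n : ℕ} (Ω : Set (EuclideanSpace ℝ (Fin n))) (μ : ℝ≥0∞)
    (f : EuclideanSpace ℝ (Fin n) → ℝ) : ℝ≥0∞ :=
  ⨆ (x : EuclideanSpace ℝ (Fin n)) (r : ℝ) (_ : 0 < r) (_ : ENNReal.ofReal r < μ)
    (_ : closedBall x r ⊆ Ω),
    (volume (closedBall x r))⁻¹ *
      ∫⁻ y in closedBall x r, ENNReal.ofReal |f y - ⨍ z in closedBall x r, f z|

/-- The uniformly local `L¹` norm over a set `S` (with ball radius `1`). -/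
noncomputable def ulNorm {n : ℕ} (S : Set (EuclideanSpace ℝ (Fin n)))
    (f : EuclideanSpace ℝ (Fin n) → ℝ) : ℝ≥0∞ :=
  ⨆ x : EuclideanSpace ℝ (Fin n), ∫⁻ y in S ∩ closedBall x 1, ENNReal.ofReal |f y|

/-- The boundary seminorm `[f]_{b^ν}`. -/
noncomputable def bSemi {n : ℕ} (Ω : Set (EuclideanSpace ℝ (Fin n))) (ν : ℝ≥0∞)
    (f : EuclideanSpace ℝ (Fin n) → ℝ) : ℝ≥0∞ :=
  ⨆ (x : EuclideanSpace ℝ (Fin n)) (_ : x ∈ frontier Ω) (r : ℝ) (_ : 0 < r)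
    (_ : ENNReal.ofReal r < ν),
    (ENNReal.ofReal (r ^ n))⁻¹ * ∫⁻ y in Ω ∩ closedBall x r, ENNReal.ofReal |f y|

/-- The tubular neighborhood `Γ_δ = {x ∈ Ω | d_Ω(x) < δ}` of the boundary inside `Ω`. -/
def tub {n : ℕ} (Ω : Set (EuclideanSpace ℝ (Fin n))) (δ : ℝ≥0∞) :
    Set (EuclideanSpace ℝ (Fin n)) :=
  {x ∈ Ω | ENNReal.ofReal (Metric.infDist x (frontier Ω)) < δ}

/-- The average over a set of finite positive volume is within the mean deviation of `f` from any
constant `c` of that constant. -/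
lemma ofReal_abs_average_sub_le {n : ℕ} {s : Set (EuclideanSpace ℝ (Fin n))}
    {f : EuclideanSpace ℝ (Fin n) → ℝ} (hs0 : volume s ≠ 0) (hs : volume s ≠ ⊤)
    (hf : IntegrableOn f s) (c : ℝ) :
    ENNReal.ofReal |(⨍ y in s, f y) - c| ≤
      (volume s)⁻¹ * ∫⁻ y in s, ENNReal.ofReal |f y - c| := by
  have : NeZero (volume.restrict s) := ⟨by simpa using hs0⟩
  have : IsFiniteMeasure (volume.restrict s) := ⟨by simpa using hs.lt_top⟩
  have h1 : (⨍ y in s, f y) - c = ⨍ y in s, (f y - c) := by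
    have h := average_const (volume.restrict s) c
    simp only [average] at h ⊢
    rw [integral_sub _ (integrable_const _), h]
    exact hf.to_average
  rw [h1, ← Real.enorm_eq_ofReal_abs]
  refine (enorm_integral_le_lintegral_enorm _).trans (le_of_eq ?_)
  rw [lintegral_smul_measure]
  simp [Real.enorm_eq_ofReal_abs]

lemma volume_closedBall_ne_zero {n : ℕ} (x : EuclideanSpace ℝ (Fin n)) {r : ℝ} (hr : 0 < r) :
    volume (closedBall x r) ≠ 0 :=
  (measure_closedBall_pos volume x hr).ne'

lemma volume_closedBall_ne_top {n : ℕ} (x : EuclideanSpace ℝ (Fin n)) (r : ℝ) :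
    volume (closedBall x r) ≠ ⊤ :=
  measure_closedBall_lt_top.ne

lemma volume_closedBall_le_of_le_mul {n : ℕ} (x y : EuclideanSpace ℝ (Fin n)) {r r' a : ℝ}
    (hr : 0 ≤ r) (hr' : 0 ≤ r') (ha : 0 ≤ a) (h : r' ≤ a * r) :
    volume (closedBall x r') ≤ ENNReal.ofReal (a ^ n) * volume (closedBall y r) := by
  rw [Measure.addHaar_closedBall _ _ hr, Measure.addHaar_closedBall _ _ hr', ← mul_assoc,
    ← ENNReal.ofReal_mul (by positivity), finrank_euclideanSpace_fin, ← mul_pow]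
  gcongr

/-- Averages over two nested balls of comparable radii differ by a multiple of the mean
oscillation over the larger one. -/
lemma ofReal_abs_average_sub_average_le {n : ℕ} {x y : EuclideanSpace ℝ (Fin n)} {r r' a : ℝ}
    {f : EuclideanSpace ℝ (Fin n) → ℝ} {A : ℝ≥0∞} (hr : 0 < r) (ha : 0 ≤ a) (h : r' ≤ a * r)
    (hsub : closedBall y r ⊆ closedBall x r') (hr' : 0 ≤ r')
    (hf : IntegrableOn f (closedBall x r'))
    (hA : ∫⁻ w in closedBall x r', ENNReal.ofReal |f w - ⨍ z in closedBall x r', f z| ≤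
      A * volume (closedBall x r')) :
    ENNReal.ofReal |(⨍ w in closedBall y r, f w) - ⨍ z in closedBall x r', f z| ≤
      ENNReal.ofReal (a ^ n) * A := by
  have h0 := volume_closedBall_ne_zero y hr
  have ht := volume_closedBall_ne_top y r
  refine (ofReal_abs_average_sub_le h0 ht (hf.mono_set hsub) _).trans ?_
  calc _ ≤ (volume (closedBall y r))⁻¹ *
        (A * (ENNReal.ofReal (a ^ n) * volume (closedBall y r))) := by
        gcongr
        refine (lintegral_mono_set hsub).trans (hA.trans ?_)
        gcongr
        exact volume_closedBall_le_of_le_mul x y hr.le hr' ha h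
    _ = (volume (closedBall y r))⁻¹ * volume (closedBall y r) * (ENNReal.ofReal (a ^ n) * A) := by
        ring
    _ = _ := by rw [ENNReal.inv_mul_cancel h0 ht, one_mul]

lemma ofReal_abs_sub_le (a b c : ℝ) :
    ENNReal.ofReal |a - c| ≤ ENNReal.ofReal |a - b| + ENNReal.ofReal |b - c| := by
  rw [← ENNReal.ofReal_add (abs_nonneg _) (abs_nonneg _)]
  exact ENNReal.ofReal_le_ofReal (abs_sub_le a b c)

/-- A point of a ball can be moved towards the centre so that its distance to the sphere is
multiplied by `1 + l`, unless this reaches the centre. -/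
lemma exists_dist_le_of_mem_ball {n : ℕ} {x z : EuclideanSpace ℝ (Fin n)} {R l : ℝ}
    (hl : 0 < l) (hz : dist z x < R) :
    ∃ z', dist z z' ≤ l * (R - dist z x) ∧ dist z' x ≤ dist z x ∧
      R - dist z' x ≤ (1 + l) * (R - dist z x) ∧
      (dist z' x = 0 ∨ R - dist z' x = (1 + l) * (R - dist z x)) := by
  have hd : 0 < l * (R - dist z x) := mul_pos hl (by linarith)
  rcases le_or_gt (dist z x) (l * (R - dist z x)) with h | h
  · exact ⟨x, h, by simp, by simp; linarith, by simp⟩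
  · have hp : 0 < dist z x := hd.trans h
    set t : ℝ := l * (R - dist z x) / dist z x with ht
    have ht0 : 0 ≤ t := by positivity
    have ht1 : t ≤ 1 := (div_le_one hp).2 h.le
    have htd : t * dist z x = l * (R - dist z x) := div_mul_cancel₀ _ hp.ne'
    have h1 : dist z (AffineMap.lineMap z x t) = l * (R - dist z x) := by
      rw [dist_left_lineMap, Real.norm_of_nonneg ht0, htd]
    have h2 : dist (AffineMap.lineMap z x t) x = dist z x - l * (R - dist z x) := by
      rw [dist_lineMap_right, Real.norm_of_nonneg (by linarith), ← htd]; ring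
    exact ⟨AffineMap.lineMap z x t, h1.le, by linarith, by linarith, Or.inr (by linarith)⟩

/-- The logarithmic growth of averages over Whitney balls towards the boundary of a ball. -/
lemma ofReal_abs_average_whitney_sub_le {n : ℕ} {x : EuclideanSpace ℝ (Fin n)} {R l : ℝ}
    {f : EuclideanSpace ℝ (Fin n) → ℝ} {A : ℝ≥0∞} (hR : 0 < R) (hl : 0 < l) (hl2 : 2 * l ≤ 1)
    (hf : IntegrableOn f (closedBall x R))
    (hA : ∀ y r, 0 < r → r ≤ 2 * l * R → closedBall y r ⊆ closedBall x R →
      ∫⁻ w in closedBall y r, ENNReal.ofReal |f w - ⨍ z in closedBall y r, f z| ≤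
      A * volume (closedBall y r)) (k : ℕ) :
    ∀ z, dist z x < R → R ≤ (1 + l) ^ k * (R - dist z x) →
      ENNReal.ofReal |(⨍ w in closedBall z (l * (R - dist z x)), f w) -
        ⨍ w in closedBall x (l * R), f w| ≤ k * (2 * ENNReal.ofReal (4 ^ n) * A) := by
  induction k with
  | zero =>
    intro z hz h
    have h0 : dist z x = 0 := le_antisymm (by linarith) dist_nonneg
    obtain rfl := dist_eq_zero.1 h0
    simp
  | succ k ih =>
    intro z hz h
    obtain ⟨z', h1, h2, h3, h4⟩ := exists_dist_le_of_mem_ball hl hz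
    have hd : 0 < R - dist z x := by linarith
    have hd' : 0 < R - dist z' x := by linarith
    have hk : R ≤ (1 + l) ^ k * (R - dist z' x) := by
      rcases h4 with h4 | h4
      · rw [h4, sub_zero]
        exact le_mul_of_one_le_left hR.le (one_le_pow₀ (by linarith))
      · rw [h4, ← mul_assoc, ← pow_succ]; exact h
    have hbig : closedBall z' (2 * l * (R - dist z' x)) ⊆ closedBall x R :=
      closedBall_subset_closedBall' (by nlinarith)
    have hb0 : 0 < 2 * l * (R - dist z' x) := by positivity
    have hosc := hA z' _ hb0 (by
      have := dist_nonneg (x := z') (y := x)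
      gcongr; linarith) hbig
    have e1 := ofReal_abs_average_sub_average_le (a := 4) (y := z) (r := l * (R - dist z x))
      (by positivity) (by norm_num) (by nlinarith)
      (closedBall_subset_closedBall' (by nlinarith)) hb0.le (hf.mono_set hbig) hosc
    have e2 := ofReal_abs_average_sub_average_le (a := 4) (y := z') (r := l * (R - dist z' x))
      (by positivity) (by norm_num) (by nlinarith)
      (closedBall_subset_closedBall (by nlinarith)) hb0.le (hf.mono_set hbig) hosc
    rw [abs_sub_comm] at e2
    have e3 := ih z' (by linarith) hk
    refine (ofReal_abs_sub_le _ (⨍ w in closedBall z' (l * (R - dist z' x)), f w) _).trans ?_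
    refine (add_le_add ((ofReal_abs_sub_le _ _ _).trans (add_le_add e1 e2)) e3).trans
      (le_of_eq ?_)
    push_cast
    ring

/-- The set of points of the ball at relative distance less than `q ^ (1 - j)` to the sphere. -/
def sphereLayer {n : ℕ} (x : EuclideanSpace ℝ (Fin n)) (R q : ℝ) (j : ℕ) :
    Set (EuclideanSpace ℝ (Fin n)) :=
  {w ∈ closedBall x R | q ^ j * (R - dist w x) < q * R}

lemma measurableSet_sphereLayer {n : ℕ} (x : EuclideanSpace ℝ (Fin n)) (R q : ℝ) (j : ℕ) :
    MeasurableSet (sphereLayer x R q j) := by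
  have h : IsOpen {w : EuclideanSpace ℝ (Fin n) | q ^ j * (R - dist w x) < q * R} :=
    isOpen_lt (by fun_prop) continuous_const
  exact measurableSet_closedBall.inter h.measurableSet

lemma volume_sphereLayer_le {n : ℕ} (x : EuclideanSpace ℝ (Fin n)) {R q : ℝ} (hR : 0 < R)
    (hq : 1 < q) (j : ℕ) :
    volume (sphereLayer x R q j) ≤
      ENNReal.ofReal ((n + 1) * q * q⁻¹ ^ j) * volume (closedBall x R) := by
  have hq0 : 0 < q := by linarith
  rcases j with _ | j
  · refine (measure_mono (fun w hw => hw.1)).trans ?_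
    refine le_mul_of_one_le_left' (ENNReal.one_le_ofReal.2 ?_)
    have : (0 : ℝ) ≤ n := n.cast_nonneg
    rw [pow_zero]; nlinarith
  · set s : ℝ := q⁻¹ ^ j with hs
    have hs0 : 0 < s := by positivity
    have hs1 : s ≤ 1 := pow_le_one₀ (by positivity) (inv_le_one_of_one_le₀ hq.le)
    have hqs : q ^ j * s = 1 := by
      rw [hs, ← mul_pow, mul_inv_cancel₀ hq0.ne', one_pow]
    have hsub : closedBall x ((1 - s) * R) ⊆ closedBall x R :=
      closedBall_subset_closedBall (by nlinarith)
    have hle : sphereLayer x R q (j + 1) ⊆ closedBall x R \ closedBall x ((1 - s) * R) := by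
      rintro w ⟨hw, hw'⟩
      refine ⟨hw, fun h => ?_⟩
      rw [mem_closedBall] at h
      have h1 : s * R ≤ R - dist w x := by linarith
      have h2 : q ^ (j + 1) * (s * R) ≤ q ^ (j + 1) * (R - dist w x) := by gcongr
      have h3 : q ^ (j + 1) * (s * R) = q * R := by
        calc _ = q * (q ^ j * s) * R := by ring
          _ = _ := by rw [hqs, mul_one]
      linarith
    refine (measure_mono hle).trans ?_
    rw [measure_sdiff hsub measurableSet_closedBall.nullMeasurableSet
      (volume_closedBall_ne_top _ _), Measure.addHaar_closedBall _ _ hR.le,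
      Measure.addHaar_closedBall _ _ (mul_nonneg (by linarith) hR.le), finrank_euclideanSpace_fin,
      ← mul_assoc, ← ENNReal.ofReal_mul (by positivity),
      ← ENNReal.sub_mul (fun _ _ => measure_ball_lt_top.ne),
      ← ENNReal.ofReal_sub _ (pow_nonneg (mul_nonneg (by linarith) hR.le) _)]
    gcongr
    have hb := one_add_mul_le_pow (a := -s) (by linarith) n
    have hRn : 0 < R ^ n := by positivity
    have h4 : (n + 1) * q * q⁻¹ ^ (j + 1) = (n + 1) * s := by
      rw [pow_succ, ← hs]; field_simp
    rw [h4, mul_pow]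
    have h5 : (1 - s) ^ n = (1 + -s) ^ n := by ring
    rw [h5]
    nlinarith [mul_pos hs0 hRn, mul_le_mul_of_nonneg_right hb hRn.le]

/-- The sum of relative volumes of the layers. -/
noncomputable def layerSum (n : ℕ) (q : ℝ) : ℝ≥0∞ :=
  ∑' j : ℕ, ENNReal.ofReal ((n + 1) * q * q⁻¹ ^ j)

lemma layerSum_ne_top (n : ℕ) {q : ℝ} (hq : 1 < q) : layerSum n q ≠ ⊤ := by
  have hs : Summable fun j : ℕ => (n + 1) * q * q⁻¹ ^ j :=
    (summable_geometric_of_lt_one (by positivity) (inv_lt_one_of_one_lt₀ hq)).mul_left _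
  exact hs.tsum_ofReal_ne_top

/-- The number of layers containing a point. -/
noncomputable def layerCount {n : ℕ} (x : EuclideanSpace ℝ (Fin n)) (R q : ℝ)
    (w : EuclideanSpace ℝ (Fin n)) : ℝ≥0∞ :=
  ∑' j : ℕ, (sphereLayer x R q j).indicator 1 w

lemma lintegral_layerCount_le {n : ℕ} (x : EuclideanSpace ℝ (Fin n)) {R q : ℝ} (hR : 0 < R)
    (hq : 1 < q) :
    ∫⁻ w, layerCount x R q w ≤ layerSum n q * volume (closedBall x R) := by
  unfold layerCount layerSum
  rw [lintegral_tsum fun j =>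
    (measurable_one.indicator (measurableSet_sphereLayer x R q j)).aemeasurable,
    ← ENNReal.tsum_mul_right]
  refine ENNReal.tsum_le_tsum fun j => ?_
  rw [lintegral_indicator_one (measurableSet_sphereLayer x R q j)]
  exact volume_sphereLayer_le x hR hq j

/-- Mean deviation over a ball from its central average, controlled by the oscillation over
small balls inside. -/
lemma lintegral_abs_sub_le {n : ℕ} {x : EuclideanSpace ℝ (Fin n)} {R l : ℝ}
    {f : EuclideanSpace ℝ (Fin n) → ℝ} {A : ℝ≥0∞} (hR : 0 < R) (hl : 0 < l) (hl2 : 2 * l ≤ 1)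
    (hf : IntegrableOn f (closedBall x R))
    (hA : ∀ y r, 0 < r → r ≤ 2 * l * R → closedBall y r ⊆ closedBall x R →
      ∫⁻ w in closedBall y r, ENNReal.ofReal |f w - ⨍ z in closedBall y r, f z| ≤
      A * volume (closedBall y r)) :
    ∫⁻ w in closedBall x R, ENNReal.ofReal |f w - ⨍ z in closedBall x (l * R), f z| ≤
      ENNReal.ofReal (5 ^ n) * (1 + 2 * ENNReal.ofReal (4 ^ n) * layerSum n (1 + l)) * A *
        volume (closedBall x R) := by
  set c := ⨍ z in closedBall x (l * R), f z
  set K : ℝ≥0∞ := 2 * ENNReal.ofReal (4 ^ n) with hK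
  set G := layerCount x R (1 + l) with hG
  have hGm : Measurable G := Measurable.tsum fun j =>
    measurable_one.indicator (measurableSet_sphereLayer x R (1 + l) j)
  obtain ⟨u, hu, hdisj, hcov⟩ := Vitali.exists_disjoint_subfamily_covering_enlargement_closedBall
    (ball x R) id (fun z => l * (R - dist z x) / 5) (l * R / 5) (fun z _ => by
      have := dist_nonneg (x := z) (y := x)
      gcongr; linarith) 5 (by norm_num)
  simp only [id] at hdisj hcov
  have hpos : ∀ z ∈ ball x R, 0 < R - dist z x := fun z hz => by
    rw [mem_ball] at hz; linarith
  have hcount : u.Countable := hdisj.countable_of_nonempty_interior fun z hz => by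
    have := hpos z (hu hz)
    exact ⟨z, ball_subset_interior_closedBall (mem_ball_self (by positivity))⟩
  have hsmall : ∀ z ∈ u, ∫⁻ w in closedBall z (l * (R - dist z x)), ENNReal.ofReal |f w - c| ≤
      ENNReal.ofReal (5 ^ n) * A *
        ∫⁻ w in closedBall z (l * (R - dist z x) / 5), (1 + K * G w) := by
    intro z hz
    have hd := hpos z (hu hz)
    have hzR : dist z x < R := hu hz
    have hsub : closedBall z (l * (R - dist z x)) ⊆ closedBall x R :=
      closedBall_subset_closedBall' (by nlinarith)
    have hex : ∃ k : ℕ, R ≤ (1 + l) ^ k * (R - dist z x) := by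
      obtain ⟨k, hk⟩ := pow_unbounded_of_one_lt (R / (R - dist z x)) (by linarith : 1 < 1 + l)
      exact ⟨k, ((div_lt_iff₀ hd).1 hk).le⟩
    obtain ⟨k, hk, hmin⟩ : ∃ k : ℕ, R ≤ (1 + l) ^ k * (R - dist z x) ∧
        ∀ j < k, (1 + l) ^ j * (R - dist z x) < R := by
      classical
      exact ⟨Nat.find hex, Nat.find_spec hex, fun j hj => not_le.1 (Nat.find_min hex hj)⟩
    have havg := ofReal_abs_average_whitney_sub_le hR hl hl2 hf hA k z hzR hk
    have hosc := hA z (l * (R - dist z x)) (by positivity)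
      (by nlinarith [dist_nonneg (x := z) (y := x)]) hsub
    have hkG : ∀ w ∈ closedBall z (l * (R - dist z x) / 5), (k : ℝ≥0∞) ≤ G w := by
      intro w hw
      have hwz : dist w z ≤ l * (R - dist z x) / 5 := hw
      have ht := dist_triangle z w x
      have ht' := dist_triangle w z x
      rw [dist_comm z w] at ht
      have hmem : ∀ j ∈ Finset.range k, (sphereLayer x R (1 + l) j).indicator
          (1 : EuclideanSpace ℝ (Fin n) → ℝ≥0∞) w = 1 := by
        intro j hj
        rw [Set.indicator_of_mem, Pi.one_apply]
        refine ⟨by rw [mem_closedBall]; nlinarith, ?_⟩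
        calc (1 + l) ^ j * (R - dist w x) ≤ (1 + l) ^ j * ((1 + l) * (R - dist z x)) := by
              gcongr; nlinarith
          _ = (1 + l) * ((1 + l) ^ j * (R - dist z x)) := by ring
          _ < (1 + l) * R := by
              gcongr; exact hmin j (Finset.mem_range.1 hj)
      calc (k : ℝ≥0∞) = ∑ j ∈ Finset.range k, (sphereLayer x R (1 + l) j).indicator 1 w := by
            rw [Finset.sum_congr rfl hmem]; simp
        _ ≤ _ := ENNReal.sum_le_tsum _
    have hvol := volume_closedBall_le_of_le_mul z z (r := l * (R - dist z x) / 5)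
      (r' := l * (R - dist z x)) (a := 5) (by positivity) (by positivity) (by norm_num)
      (by linarith)
    calc _ ≤ ∫⁻ w in closedBall z (l * (R - dist z x)),
          (ENNReal.ofReal |f w - ⨍ y in closedBall z (l * (R - dist z x)), f y| + k * (K * A)) :=
          lintegral_mono fun w => (ofReal_abs_sub_le _ _ _).trans (by gcongr)
      _ = (∫⁻ w in closedBall z (l * (R - dist z x)),
          ENNReal.ofReal |f w - ⨍ y in closedBall z (l * (R - dist z x)), f y|) +
            k * (K * A) * volume (closedBall z (l * (R - dist z x))) := by
          rw [lintegral_add_right _ measurable_const, setLIntegral_const]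
      _ ≤ A * volume (closedBall z (l * (R - dist z x))) +
            k * (K * A) * volume (closedBall z (l * (R - dist z x))) := by gcongr
      _ = A * (1 + K * k) * volume (closedBall z (l * (R - dist z x))) := by ring
      _ ≤ A * (1 + K * k) *
          (ENNReal.ofReal (5 ^ n) * volume (closedBall z (l * (R - dist z x) / 5))) := by
          gcongr
      _ = ENNReal.ofReal (5 ^ n) * A *
          ∫⁻ w in closedBall z (l * (R - dist z x) / 5), (1 + K * k) := by
          rw [setLIntegral_const]; ring
      _ ≤ _ := by
          refine mul_le_mul' le_rfl (setLIntegral_mono' measurableSet_closedBall fun w hw => ?_)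
          gcongr
          exact hkG w hw
  have hball : ball x R ⊆ ⋃ z ∈ u, closedBall z (l * (R - dist z x)) := by
    intro z hz
    have := hpos z hz
    obtain ⟨b, hb, hsub⟩ := hcov z hz
    rw [mul_div_cancel₀ _ (by norm_num : (5 : ℝ) ≠ 0)] at hsub
    exact Set.mem_biUnion hb (hsub (mem_closedBall_self (by positivity)))
  have hae : (closedBall x R : Set _) =ᵐ[volume] ball x R := by
    refine (ae_eq_of_subset_of_measure_ge ball_subset_closedBall ?_
      measurableSet_ball.nullMeasurableSet (volume_closedBall_ne_top x R)).symm
    rw [Measure.addHaar_closedBall _ _ hR.le, Measure.addHaar_ball_of_pos _ _ hR]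
  have hin : ⋃ z ∈ u, closedBall z (l * (R - dist z x) / 5) ⊆ closedBall x R := by
    refine Set.iUnion₂_subset fun z hz => closedBall_subset_closedBall' ?_
    nlinarith [hpos z (hu hz)]
  calc _ = ∫⁻ w in ball x R, ENNReal.ofReal |f w - c| := setLIntegral_congr hae
    _ ≤ ∫⁻ w in ⋃ z ∈ u, closedBall z (l * (R - dist z x)), ENNReal.ofReal |f w - c| :=
        lintegral_mono_set hball
    _ ≤ ∑' z : u, ∫⁻ w in closedBall z.1 (l * (R - dist z.1 x)),
          ENNReal.ofReal |f w - c| := by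
        have := hcount.to_subtype
        rw [Set.biUnion_eq_iUnion]
        exact lintegral_iUnion_le _ _
    _ ≤ ∑' z : u, ENNReal.ofReal (5 ^ n) * A *
          ∫⁻ w in closedBall z.1 (l * (R - dist z.1 x) / 5), (1 + K * G w) :=
        ENNReal.tsum_le_tsum fun z => hsmall z z.2
    _ = ENNReal.ofReal (5 ^ n) * A *
          ∫⁻ w in ⋃ z ∈ u, closedBall z (l * (R - dist z x) / 5), (1 + K * G w) := by
        rw [ENNReal.tsum_mul_left,
          lintegral_biUnion hcount (fun _ _ => measurableSet_closedBall) hdisj]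
    _ ≤ ENNReal.ofReal (5 ^ n) * A * ∫⁻ w in closedBall x R, (1 + K * G w) := by
        gcongr
    _ = ENNReal.ofReal (5 ^ n) * A *
          (volume (closedBall x R) + K * ∫⁻ w in closedBall x R, G w) := by
        rw [lintegral_add_left measurable_const, setLIntegral_const, one_mul,
          lintegral_const_mul _ hGm]
    _ ≤ ENNReal.ofReal (5 ^ n) * A *
          (volume (closedBall x R) + K * (layerSum n (1 + l) * volume (closedBall x R))) := by
        gcongr
        exact (setLIntegral_le_lintegral _ _).trans (lintegral_layerCount_le x hR (by linarith))
    _ = _ := by ring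

/-- The mean oscillation is at most twice the mean deviation from any constant. -/
lemma lintegral_abs_sub_average_le {n : ℕ} {s : Set (EuclideanSpace ℝ (Fin n))}
    {f : EuclideanSpace ℝ (Fin n) → ℝ} (hs0 : volume s ≠ 0) (hs : volume s ≠ ⊤)
    (hf : IntegrableOn f s) (c : ℝ) :
    ∫⁻ y in s, ENNReal.ofReal |f y - ⨍ z in s, f z| ≤
      2 * ∫⁻ y in s, ENNReal.ofReal |f y - c| := by
  have h := ofReal_abs_average_sub_le hs0 hs hf c
  rw [abs_sub_comm] at h
  calc _ ≤ ∫⁻ y in s, (ENNReal.ofReal |f y - c| +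
        (volume s)⁻¹ * ∫⁻ y in s, ENNReal.ofReal |f y - c|) :=
        lintegral_mono fun y => (ofReal_abs_sub_le _ c _).trans (by gcongr)
    _ = (∫⁻ y in s, ENNReal.ofReal |f y - c|) +
        (volume s)⁻¹ * volume s * ∫⁻ y in s, ENNReal.ofReal |f y - c| := by
        rw [lintegral_add_right _ measurable_const, setLIntegral_const]; ring
    _ = _ := by rw [ENNReal.inv_mul_cancel hs0 hs, one_mul, two_mul]

lemma lintegral_le_bmoSemi_mul {n : ℕ} {Ω : Set (EuclideanSpace ℝ (Fin n))} {μ : ℝ≥0∞}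
    {f : EuclideanSpace ℝ (Fin n) → ℝ} {x : EuclideanSpace ℝ (Fin n)} {r : ℝ} (hr : 0 < r)
    (hrμ : ENNReal.ofReal r < μ) (hsub : closedBall x r ⊆ Ω) :
    ∫⁻ y in closedBall x r, ENNReal.ofReal |f y - ⨍ z in closedBall x r, f z| ≤
      bmoSemi Ω μ f * volume (closedBall x r) := by
  rw [mul_comm, ← ENNReal.inv_mul_le_iff (volume_closedBall_ne_zero x hr)
    (volume_closedBall_ne_top x r)]
  exact le_iSup_of_le x (le_iSup_of_le r (le_iSup_of_le hr (le_iSup_of_le hrμ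
    (le_iSup_of_le hsub le_rfl))))

lemma bmoSemi_mono {n : ℕ} (Ω : Set (EuclideanSpace ℝ (Fin n))) {μ ν : ℝ≥0∞} (h : μ ≤ ν)
    (f : EuclideanSpace ℝ (Fin n) → ℝ) : bmoSemi Ω μ f ≤ bmoSemi Ω ν f :=
  iSup_mono fun _ => iSup_mono fun _ => iSup_mono fun _ =>
    iSup_mono' fun hr => ⟨hr.trans_le h, le_rfl⟩

/-- equivalence of the seminorms `[·]_{BMO^{μ₁}}` and `[·]_{BMO^{μ₂}}`
for `0 < μ₁ < μ₂ < ∞`, with a constant depending only on `n, μ₁, μ₂`. -/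
theorem bmo_seminorm_equiv (n : ℕ) (μ₁ μ₂ : ℝ) (hμ₁ : 0 < μ₁) (hμ : μ₁ < μ₂) :
    ∃ C : ℝ, 0 < C ∧
      ∀ (Ω : Set (EuclideanSpace ℝ (Fin n))), Ω.Nonempty → IsOpen Ω → IsConnected Ω →
        ∀ f : EuclideanSpace ℝ (Fin n) → ℝ, LocallyIntegrableOn f Ω →
          bmoSemi Ω (ENNReal.ofReal μ₁) f ≤ bmoSemi Ω (ENNReal.ofReal μ₂) f ∧
          bmoSemi Ω (ENNReal.ofReal μ₂) f ≤ ENNReal.ofReal C * bmoSemi Ω (ENNReal.ofReal μ₁) f := by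
  have hμ₂ : 0 < μ₂ := hμ₁.trans hμ
  set l : ℝ := μ₁ / (2 * μ₂) with hl
  have hl0 : 0 < l := by positivity
  have hlμ : 2 * l * μ₂ = μ₁ := by rw [hl]; field_simp
  have hl2 : 2 * l ≤ 1 := by nlinarith
  set D : ℝ≥0∞ :=
    2 * (ENNReal.ofReal (5 ^ n) * (1 + 2 * ENNReal.ofReal (4 ^ n) * layerSum n (1 + l))) with hD
  have hDtop : D ≠ ⊤ := by
    have := layerSum_ne_top n (by linarith : 1 < 1 + l)
    finiteness
  have hD0 : D ≠ 0 := by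
    simp [hD]
  refine ⟨D.toReal, ENNReal.toReal_pos hD0 hDtop, fun Ω _ _ _ f hf =>
    ⟨bmoSemi_mono Ω (ENNReal.ofReal_le_ofReal hμ.le) f, ?_⟩⟩
  rw [ENNReal.ofReal_toReal hDtop]
  refine iSup_le fun x => iSup_le fun R => iSup_le fun hR => iSup_le fun hRμ =>
    iSup_le fun hsub => ?_
  replace hRμ : R < μ₂ := (ENNReal.ofReal_lt_ofReal_iff hμ₂).1 hRμ
  have hint : IntegrableOn f (closedBall x R) :=
    hf.integrableOn_compact_subset hsub (isCompact_closedBall x R)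
  have h0 := volume_closedBall_ne_zero x hR
  have ht := volume_closedBall_ne_top x R
  rw [ENNReal.inv_mul_le_iff h0 ht]
  refine (lintegral_abs_sub_average_le h0 ht hint (⨍ z in closedBall x (l * R), f z)).trans ?_
  have hmain := lintegral_abs_sub_le (A := bmoSemi Ω (ENNReal.ofReal μ₁) f) hR hl0 hl2 hint
    fun y r hr hrl hy => lintegral_le_bmoSemi_mul hr
      ((ENNReal.ofReal_lt_ofReal_iff hμ₁).2 (by nlinarith)) (hy.trans hsub)
  calc _ ≤ 2 * _ := mul_le_mul_right hmain 2
    _ = _ := by rw [hD]; ring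
end

section
/- Let Ω be a nonempty open connected subset of ℝⁿ, let 0 < δ₁ < δ₂ < ∞ and μ ∈ (0,∞]. Then there exists a constant C > 0, depending only on n, μ, δ₁, δ₂ and Ω, such that ‖f‖_{L¹_ul(Γ_{δ₂})} ≤ C·( [f]_{BMO^μ(Ω)} + ‖f‖_{L¹_ul(Γ_{δ₁})} ) for every f ∈ L¹_loc(Ω). In particular the norms [f]_{BMO^μ(Ω)} + ‖f‖_{L¹_ul(Γ_{δ₁})} and [f]_{BMO^μ(Ω)} + ‖f‖_{L¹_ul(Γ_{δ₂})} are equivalent. -/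
open MeasureTheory Metric ENNReal

/-- A closed ball centred in `Ω` with radius less than the distance to the frontier lies in `Ω`. -/
theorem closedBall_subset_of_lt_infDist_frontier {n : ℕ} {Ω : Set (EuclideanSpace ℝ (Fin n))}
    {x : EuclideanSpace ℝ (Fin n)} {r : ℝ} (hx : x ∈ Ω) (h0 : 0 ≤ r)
    (hr : r < infDist x (frontier Ω)) : closedBall x r ⊆ Ω := by
  have hdisj : ∀ q ∈ closedBall x r, q ∉ frontier Ω := fun q hq hqf => by
    have h1 := infDist_le_dist_of_mem (x := x) hqf
    rw [mem_closedBall, dist_comm] at hq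
    linarith
  have hint : ∀ q ∈ closedBall x r, q ∈ Ω → q ∈ interior Ω := fun q hq hqΩ => by
    by_contra hqi
    exact hdisj q hq ⟨subset_closure hqΩ, hqi⟩
  have hsub : closedBall x r ⊆ interior Ω ∪ (closure Ω)ᶜ := fun q hq => by
    by_contra hqu
    rw [Set.mem_union, not_or, Set.notMem_compl_iff] at hqu
    exact hdisj q hq ⟨hqu.2, hqu.1⟩
  have hxr : x ∈ closedBall x r := mem_closedBall_self h0
  exact ((convex_closedBall x r).isPreconnected.subset_left_of_subset_union isOpen_interior
    isClosed_closure.isOpen_compl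
    (Set.disjoint_compl_right_iff_subset.2 (interior_subset.trans subset_closure)) hsub
    ⟨x, hxr, hint x hxr hx⟩).trans interior_subset

/-- The seminorm bounds the total oscillation over each admissible ball. -/
theorem lintegral_oscillation_le {n : ℕ} {Ω : Set (EuclideanSpace ℝ (Fin n))} {μ : ℝ≥0∞}
    (f : EuclideanSpace ℝ (Fin n) → ℝ) {y : EuclideanSpace ℝ (Fin n)} {ρ : ℝ} (hρ : 0 < ρ)
    (hρμ : ENNReal.ofReal ρ < μ) (hy : closedBall y ρ ⊆ Ω) :
    ∫⁻ w in closedBall y ρ, ENNReal.ofReal |f w - ⨍ z in closedBall y ρ, f z| ≤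
      volume (closedBall y ρ) * bmoSemi Ω μ f := by
  have h : (volume (closedBall y ρ))⁻¹ *
      ∫⁻ w in closedBall y ρ, ENNReal.ofReal |f w - ⨍ z in closedBall y ρ, f z| ≤
      bmoSemi Ω μ f :=
    le_iSup_of_le y <| le_iSup_of_le ρ <| le_iSup_of_le hρ <| le_iSup_of_le hρμ <|
      le_iSup_of_le hy le_rfl
  have hV0 : volume (closedBall y ρ) ≠ 0 := (measure_closedBall_pos volume y hρ).ne'
  have hVt : volume (closedBall y ρ) ≠ ∞ := measure_closedBall_lt_top.ne
  calc _ = volume (closedBall y ρ) * ((volume (closedBall y ρ))⁻¹ *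
        ∫⁻ w in closedBall y ρ, ENNReal.ofReal |f w - ⨍ z in closedBall y ρ, f z|) := by
        rw [← mul_assoc, ENNReal.mul_inv_cancel hV0 hVt, one_mul]
    _ ≤ _ := by gcongr

/-- Comparison of the `L¹` norms of `f` on two overlapping balls of the same radius. -/
theorem exists_lintegral_closedBall_le (n : ℕ) (ρ : ℝ) (hρ : 0 < ρ) :
    ∃ K : ℝ≥0∞, K ≠ ∞ ∧ ∀ (Ω : Set (EuclideanSpace ℝ (Fin n))) (μ : ℝ≥0∞)
      (f : EuclideanSpace ℝ (Fin n) → ℝ) (y y' : EuclideanSpace ℝ (Fin n)),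
      LocallyIntegrableOn f Ω → ENNReal.ofReal ρ < μ → closedBall y ρ ⊆ Ω →
      dist y y' ≤ ρ / 2 →
      ∫⁻ w in closedBall y ρ, ENNReal.ofReal |f w| ≤
        K * (bmoSemi Ω μ f + ∫⁻ w in closedBall y' ρ, ENNReal.ofReal |f w|) := by
  set V := volume (closedBall (0 : EuclideanSpace ℝ (Fin n)) ρ) with hV
  set v := volume (closedBall (0 : EuclideanSpace ℝ (Fin n)) (ρ / 2)) with hv
  have hVt : V ≠ ∞ := measure_closedBall_lt_top.ne
  have hvt : v ≠ ∞ := measure_closedBall_lt_top.ne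
  have hv0 : v ≠ 0 := (measure_closedBall_pos volume _ (half_pos hρ)).ne'
  refine ⟨V + V * v⁻¹ * (V + 1), by finiteness, ?_⟩
  intro Ω μ f y y' hf hρμ hy hyy'
  have hosc := lintegral_oscillation_le f hρ hρμ hy
  rw [Measure.addHaar_closedBall_center, ← hV] at hosc
  set m := ⨍ z in closedBall y ρ, f z
  set M := bmoSemi Ω μ f
  set A' := ∫⁻ w in closedBall y' ρ, ENNReal.ofReal |f w|
  have hs1 : closedBall y' (ρ / 2) ⊆ closedBall y ρ :=
    closedBall_subset_closedBall' (by rw [dist_comm]; linarith)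
  have hs2 : closedBall y' (ρ / 2) ⊆ closedBall y' ρ := closedBall_subset_closedBall (by linarith)
  have hint : IntegrableOn f (closedBall y' (ρ / 2)) :=
    hf.integrableOn_compact_subset (hs1.trans hy) (isCompact_closedBall _ _)
  have hm : ENNReal.ofReal |m| * v ≤ V * M + A' := by
    calc ENNReal.ofReal |m| * v
        = ∫⁻ w in closedBall y' (ρ / 2), ENNReal.ofReal |m| := by
          rw [setLIntegral_const, Measure.addHaar_closedBall_center]
      _ ≤ ∫⁻ w in closedBall y' (ρ / 2), (ENNReal.ofReal |f w - m| + ENNReal.ofReal |f w|) := by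
          refine lintegral_mono fun w => ?_
          rw [← ENNReal.ofReal_add (abs_nonneg _) (abs_nonneg _)]
          refine ENNReal.ofReal_le_ofReal ?_
          have := abs_sub_abs_le_abs_sub m (f w)
          rw [abs_sub_comm] at this
          linarith
      _ = (∫⁻ w in closedBall y' (ρ / 2), ENNReal.ofReal |f w - m|) +
            ∫⁻ w in closedBall y' (ρ / 2), ENNReal.ofReal |f w| :=
          lintegral_add_right' _ hint.aemeasurable.norm.ennreal_ofReal
      _ ≤ V * M + A' :=
          add_le_add ((lintegral_mono_set hs1).trans hosc) (lintegral_mono_set hs2)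
  have hm' : ENNReal.ofReal |m| ≤ v⁻¹ * (V * M + A') := by
    calc ENNReal.ofReal |m| = v⁻¹ * (ENNReal.ofReal |m| * v) := by
          rw [mul_comm (ENNReal.ofReal |m|), ← mul_assoc, ENNReal.inv_mul_cancel hv0 hvt, one_mul]
      _ ≤ _ := by gcongr
  calc ∫⁻ w in closedBall y ρ, ENNReal.ofReal |f w|
      ≤ ∫⁻ w in closedBall y ρ, (ENNReal.ofReal |f w - m| + ENNReal.ofReal |m|) := by
        refine lintegral_mono fun w => ?_
        rw [← ENNReal.ofReal_add (abs_nonneg _) (abs_nonneg _)]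
        refine ENNReal.ofReal_le_ofReal ?_
        have := abs_sub_abs_le_abs_sub (f w) m
        linarith
    _ = (∫⁻ w in closedBall y ρ, ENNReal.ofReal |f w - m|) + ENNReal.ofReal |m| * V := by
        rw [lintegral_add_right _ measurable_const, setLIntegral_const,
          Measure.addHaar_closedBall_center]
    _ ≤ V * M + v⁻¹ * (V * M + A') * V := by gcongr
    _ ≤ V * (M + A') + v⁻¹ * (V * (M + A') + (M + A')) * V := by
        gcongr
        · exact le_self_add
        · exact le_self_add
        · exact le_add_self
    _ = (V + V * v⁻¹ * (V + 1)) * (M + A') := by ring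

/-- Iteration of a one-step comparison along a finite chain of points. -/
theorem le_pow_mul_of_chain {a : ℕ → ℝ≥0∞} {M K : ℝ≥0∞} {N : ℕ}
    (h : ∀ i < N, a i ≤ K * (M + a (i + 1))) : M + a 0 ≤ (1 + K) ^ N * (M + a N) := by
  induction N with
  | zero => simp
  | succ k ih =>
    refine (ih fun i hi => h i (hi.trans k.lt_succ_self)).trans ?_
    rw [pow_succ, mul_assoc]
    gcongr
    calc M + a k ≤ (M + a (k + 1)) + K * (M + a (k + 1)) :=
          add_le_add le_self_add (h k k.lt_succ_self)
      _ = _ := by ring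

/-- The `L¹` norm of `f` on a small ball centred in `Γ_{δ₂} \ Γ_{δ₁}` is controlled by
the seminorm and the uniformly local norm on `Γ_{δ₁}`. -/
theorem exists_lintegral_closedBall_le_of_mem_tub (n : ℕ) (μ : ℝ≥0∞) (δ₁ δ₂ ρ : ℝ)
    (hδ₁ : 0 < δ₁) (hδ : δ₁ < δ₂) (hρ : 0 < ρ) (hρμ : ENNReal.ofReal ρ < μ) (hρ1 : ρ ≤ 1)
    (hρδ : ρ ≤ δ₁ / 4) :
    ∃ K : ℝ≥0∞, K ≠ ∞ ∧ ∀ (Ω : Set (EuclideanSpace ℝ (Fin n)))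
      (f : EuclideanSpace ℝ (Fin n) → ℝ) (x : EuclideanSpace ℝ (Fin n)),
      LocallyIntegrableOn f Ω → x ∈ tub Ω (ENNReal.ofReal δ₂) \ tub Ω (ENNReal.ofReal δ₁) →
      ∫⁻ w in closedBall x ρ, ENNReal.ofReal |f w| ≤
        K * (bmoSemi Ω μ f + ulNorm (tub Ω (ENNReal.ofReal δ₁)) f) := by
  obtain ⟨K, hK, hstep⟩ := exists_lintegral_closedBall_le n ρ hρ
  obtain ⟨N, hN⟩ := exists_nat_gt (δ₂ / (ρ / 2))
  have hδ₂ : 0 < δ₂ := hδ₁.trans hδ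
  have hN0 : (0 : ℝ) < N := lt_trans (by positivity) hN
  refine ⟨(1 + K) ^ N, by finiteness, ?_⟩
  rintro Ω f x hf ⟨⟨hxΩ, hx2⟩, hx1⟩
  set d := infDist x (frontier Ω) with hd
  have hd2 : d < δ₂ := (ENNReal.ofReal_lt_ofReal_iff hδ₂).1 hx2
  have hd1 : δ₁ ≤ d := by
    by_contra hlt
    exact hx1 ⟨hxΩ, (ENNReal.ofReal_lt_ofReal_iff hδ₁).2 (not_le.1 hlt)⟩
  have hd0 : 0 < d := hδ₁.trans_le hd1
  have hfr : (frontier Ω).Nonempty := by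
    by_contra hemp
    rw [Set.not_nonempty_iff_eq_empty] at hemp
    rw [hd, hemp, infDist_empty] at hd0
    exact lt_irrefl _ hd0
  obtain ⟨z, hz, hxz⟩ := isClosed_frontier.exists_infDist_eq_dist hfr x
  rw [← hd] at hxz
  set c : ℕ → ℝ := fun i => i / N * ((d - δ₁ / 2) / d) with hc
  set y : ℕ → EuclideanSpace ℝ (Fin n) := fun i => AffineMap.lineMap x z (c i) with hy
  have hyx : ∀ i ≤ N, dist (y i) x ≤ d - δ₁ / 2 := by
    intro i hi
    have hi' : (i : ℝ) / N ≤ 1 := (div_le_one hN0).2 (by exact_mod_cast hi)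
    have hnn : 0 ≤ d - δ₁ / 2 := by linarith
    have hci : 0 ≤ c i := by simp only [hc]; positivity
    rw [hy, dist_lineMap_left, Real.norm_of_nonneg hci, ← hxz]
    calc c i * d = i / N * (d - δ₁ / 2) := by simp only [hc]; field_simp
      _ ≤ 1 * (d - δ₁ / 2) := by gcongr
      _ = _ := one_mul _
  have hyΩ : ∀ i ≤ N, closedBall (y i) ρ ⊆ Ω := fun i hi =>
    (closedBall_subset_closedBall' (ε₂ := d - δ₁ / 4) (by linarith [hyx i hi])).trans
      (closedBall_subset_of_lt_infDist_frontier hxΩ (by linarith) (by rw [← hd]; linarith))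
  have hystep : ∀ i, dist (y i) (y (i + 1)) ≤ ρ / 2 := by
    intro i
    have hnn : 0 ≤ d - δ₁ / 2 := by linarith
    rw [hy, dist_lineMap_lineMap, ← hxz, dist_comm, Real.dist_eq]
    have h1 : c (i + 1) - c i = (d - δ₁ / 2) / d / N := by
      simp only [hc]; push_cast; field_simp; ring
    rw [h1, abs_of_nonneg (by positivity)]
    calc (d - δ₁ / 2) / d / N * d = (d - δ₁ / 2) / N := by field_simp
      _ ≤ δ₂ / N := by gcongr; linarith
      _ ≤ ρ / 2 := by
        rw [div_le_iff₀ hN0]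
        rw [div_lt_iff₀ (by positivity)] at hN
        linarith
  have hy0 : y 0 = x := by simp [hy, hc]
  have hyN : dist (y N) z ≤ δ₁ / 2 := by
    have hcN : 1 - c N = δ₁ / 2 / d := by
      simp only [hc]; field_simp; ring
    rw [hy, dist_lineMap_right, ← hxz, hcN, Real.norm_of_nonneg (by positivity)]
    rw [div_mul_cancel₀ _ hd0.ne']
  have hend : closedBall (y N) ρ ⊆ tub Ω (ENNReal.ofReal δ₁) ∩ closedBall (y N) 1 := by
    intro w hw
    refine ⟨⟨hyΩ N le_rfl hw, (ENNReal.ofReal_lt_ofReal_iff hδ₁).2 ?_⟩,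
      closedBall_subset_closedBall hρ1 hw⟩
    have h1 := infDist_le_dist_of_mem (x := w) hz
    have h2 := dist_triangle w (y N) z
    have h3 := mem_closedBall.1 hw
    linarith
  have hchain := le_pow_mul_of_chain (M := bmoSemi Ω μ f) (K := K) (N := N)
    (a := fun i => ∫⁻ w in closedBall (y i) ρ, ENNReal.ofReal |f w|)
    fun i hi => hstep Ω μ f _ _ hf hρμ (hyΩ i hi.le) (hystep i)
  simp only [hy0] at hchain
  refine le_add_self.trans (hchain.trans ?_)
  gcongr
  exact (lintegral_mono_set hend).trans
    (le_iSup (fun p => ∫⁻ w in tub Ω (ENNReal.ofReal δ₁) ∩ closedBall p 1,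
      ENNReal.ofReal |f w|) (y N))

/-- for `0 < δ₁ < δ₂ < ∞` and `μ ∈ (0,∞]`, the uniformly local `L¹` norm
on `Γ_{δ₂}` is controlled by the `BMO^μ` seminorm plus the uniformly local `L¹` norm on
`Γ_{δ₁}`, with a constant depending only on `n, μ, δ₁, δ₂, Ω`. -/
theorem ul_norm_tub_equiv (n : ℕ) (μ : ℝ≥0∞) (hμ : 0 < μ) (δ₁ δ₂ : ℝ)
    (hδ₁ : 0 < δ₁) (hδ : δ₁ < δ₂) (Ω : Set (EuclideanSpace ℝ (Fin n)))
    (hne : Ω.Nonempty) (hop : IsOpen Ω) (hconn : IsConnected Ω) :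
    ∃ C : ℝ, 0 < C ∧
      ∀ f : EuclideanSpace ℝ (Fin n) → ℝ, LocallyIntegrableOn f Ω →
        ulNorm (tub Ω (ENNReal.ofReal δ₂)) f ≤
          ENNReal.ofReal C * (bmoSemi Ω μ f + ulNorm (tub Ω (ENNReal.ofReal δ₁)) f) := by
  obtain ⟨ρ₀, -, hρ₀, hρ₀μ⟩ := ENNReal.lt_iff_exists_real_btwn.1 hμ
  have hρ₀' : 0 < ρ₀ := ENNReal.ofReal_pos.1 hρ₀
  obtain ⟨ρ, hρ, hρ₀le, hρ1, hρδ⟩ : ∃ ρ : ℝ, 0 < ρ ∧ ρ ≤ ρ₀ ∧ ρ ≤ 1 ∧ ρ ≤ δ₁ / 4 :=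
    ⟨min ρ₀ (min 1 (δ₁ / 4)), by positivity, min_le_left _ _,
      (min_le_right _ _).trans (min_le_left _ _), (min_le_right _ _).trans (min_le_right _ _)⟩
  have hρμ : ENNReal.ofReal ρ < μ := (ENNReal.ofReal_le_ofReal hρ₀le).trans_lt hρ₀μ
  obtain ⟨K, hK, hball⟩ :=
    exists_lintegral_closedBall_le_of_mem_tub n μ δ₁ δ₂ ρ hδ₁ hδ hρ hρμ hρ1 hρδ
  obtain ⟨T, -, hTfin, hT⟩ := finite_approx_of_totallyBounded
    (isCompact_closedBall (0 : EuclideanSpace ℝ (Fin n)) 1).totallyBounded (ρ / 2) (half_pos hρ)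
  lift T to Finset (EuclideanSpace ℝ (Fin n)) using hTfin
  have hCt : 1 + (T.card : ℝ≥0∞) * K ≠ ∞ := by finiteness
  refine ⟨(1 + (T.card : ℝ≥0∞) * K).toReal, ENNReal.toReal_pos (by simp) hCt, fun f hf => ?_⟩
  rw [ENNReal.ofReal_toReal hCt]
  set M := bmoSemi Ω μ f
  set U := ulNorm (tub Ω (ENNReal.ofReal δ₁)) f
  refine iSup_le fun x => ?_
  set S := tub Ω (ENNReal.ofReal δ₂) \ tub Ω (ENNReal.ofReal δ₁) with hS
  have hcover : tub Ω (ENNReal.ofReal δ₂) ∩ closedBall x 1 ⊆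
      (tub Ω (ENNReal.ofReal δ₁) ∩ closedBall x 1) ∪
        ⋃ t ∈ T, S ∩ closedBall (x + t) (ρ / 2) := by
    rintro w ⟨hw2, hwx⟩
    by_cases hw1 : w ∈ tub Ω (ENNReal.ofReal δ₁)
    · exact Or.inl ⟨hw1, hwx⟩
    · refine Or.inr ?_
      have hmem : w - x ∈ closedBall (0 : EuclideanSpace ℝ (Fin n)) 1 := by
        rwa [mem_closedBall_zero_iff, ← dist_eq_norm]
      obtain ⟨t, ht, hwt⟩ := Set.mem_iUnion₂.1 (hT hmem)
      refine Set.mem_iUnion₂.2 ⟨t, ht, ⟨hw2, hw1⟩, ?_⟩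
      rw [mem_closedBall, dist_eq_norm, ← sub_sub, ← dist_eq_norm]
      exact (mem_ball.1 hwt).le
  have hpiece : ∀ t ∈ T, ∫⁻ w in S ∩ closedBall (x + t) (ρ / 2), ENNReal.ofReal |f w| ≤
      K * (M + U) := by
    intro t _
    rcases (S ∩ closedBall (x + t) (ρ / 2)).eq_empty_or_nonempty with hemp | ⟨p, hpS, hpb⟩
    · simp [hemp]
    · refine (lintegral_mono_set ?_).trans (hball Ω f p hf hpS)
      refine Set.inter_subset_right.trans (closedBall_subset_closedBall' ?_)
      rw [mem_closedBall, dist_comm] at hpb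
      linarith
  have hU : ∫⁻ w in tub Ω (ENNReal.ofReal δ₁) ∩ closedBall x 1, ENNReal.ofReal |f w| ≤ U :=
    le_iSup (fun p => ∫⁻ w in tub Ω (ENNReal.ofReal δ₁) ∩ closedBall p 1,
      ENNReal.ofReal |f w|) x
  calc ∫⁻ w in tub Ω (ENNReal.ofReal δ₂) ∩ closedBall x 1, ENNReal.ofReal |f w|
      ≤ (∫⁻ w in tub Ω (ENNReal.ofReal δ₁) ∩ closedBall x 1, ENNReal.ofReal |f w|) +
          ∫⁻ w in ⋃ t ∈ T, S ∩ closedBall (x + t) (ρ / 2), ENNReal.ofReal |f w| :=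
        (lintegral_mono_set hcover).trans (lintegral_union_le _ _ _)
    _ ≤ U + ∑ t ∈ T, ∫⁻ w in S ∩ closedBall (x + t) (ρ / 2), ENNReal.ofReal |f w| := by
        gcongr
        rw [← Finset.sum_coe_sort]
        have hset : (⋃ t ∈ T, S ∩ closedBall (x + t) (ρ / 2)) =
            ⋃ t : T, S ∩ closedBall (x + (t : EuclideanSpace ℝ (Fin n))) (ρ / 2) := by
          rw [Set.iUnion_subtype]
        rw [hset, ← tsum_fintype (L := .unconditional _)]
        exact lintegral_iUnion_le _ _
    _ ≤ (M + U) + T.card * (K * (M + U)) := by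
        gcongr
        · exact le_add_self
        · rw [← nsmul_eq_mul]
          exact Finset.sum_le_card_nsmul _ _ _ hpiece
    _ = (1 + T.card * K) * (M + U) := by ring
end

section
/- Let Ω be a nonempty open connected subset of ℝⁿ and μ ∈ (0,∞). Then there is a constant C > 0, depending only on n and μ, such that [f]_{BMO^∞(Ω)} ≤ C·( [f]_{BMO^μ(Ω)} + ‖f‖_{L¹_ul(Ω)} ) for every f ∈ L¹_loc(Ω). Consequently the spaces bmo^∞_∞(Ω) and bmo^μ_∞(Ω) coincide with equivalent norms, where ‖f‖_{bmo^μ_∞(Ω)} := [f]_{BMO^μ(Ω)} + ‖f‖_{L¹_ul(Ω)}. -/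
open MeasureTheory Metric ENNReal

/-- Averaging over all unit balls centred in the enlarged ball bounds the integral of `|f|` over
a ball by the uniformly local norm. -/
lemma lintegral_closedBall_mul_volume_le {n : ℕ} (S : Set (EuclideanSpace ℝ (Fin n)))
    (f : EuclideanSpace ℝ (Fin n) → ℝ) (x : EuclideanSpace ℝ (Fin n)) (r : ℝ)
    (hS : closedBall x r ⊆ S)
    (hf : AEMeasurable f (volume.restrict (closedBall x r))) :
    (∫⁻ y in closedBall x r, ENNReal.ofReal |f y|) *
        volume (closedBall (0 : EuclideanSpace ℝ (Fin n)) 1) ≤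
      volume (closedBall x (r + 1)) * ulNorm S f := by
  set D : Set (EuclideanSpace ℝ (Fin n) × EuclideanSpace ℝ (Fin n)) :=
    {p | dist p.2 p.1 ≤ 1}
  have hDm : MeasurableSet D :=
    (isClosed_le (by fun_prop) continuous_const).measurableSet
  have hg : AEMeasurable (fun y => ENNReal.ofReal |f y|)
      (volume.restrict (closedBall x r)) :=
    (continuous_abs.measurable.comp_aemeasurable hf).ennreal_ofReal
  calc (∫⁻ y in closedBall x r, ENNReal.ofReal |f y|) *
        volume (closedBall (0 : EuclideanSpace ℝ (Fin n)) 1)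
      = ∫⁻ y in closedBall x r, ENNReal.ofReal |f y| *
          volume (closedBall (0 : EuclideanSpace ℝ (Fin n)) 1) :=
        (lintegral_mul_const'' _ hg).symm
    _ = ∫⁻ y in closedBall x r, ∫⁻ z in closedBall x (r + 1),
          ENNReal.ofReal |f y| * D.indicator 1 (z, y) := by
        refine setLIntegral_congr_fun measurableSet_closedBall fun y hy => ?_
        have hsub : closedBall y 1 ⊆ closedBall x (r + 1) := by
          refine closedBall_subset_closedBall' ?_
          linarith [mem_closedBall.1 hy]
        have hind : (fun z => D.indicator (1 : _ × _ → ℝ≥0∞) (z, y)) =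
            (closedBall y 1).indicator 1 := by
          ext z
          simp [D, Set.indicator, mem_closedBall, dist_comm]
        have hmeas : Measurable fun z => D.indicator (1 : _ × _ → ℝ≥0∞) (z, y) := by
          rw [hind]
          exact measurable_one.indicator measurableSet_closedBall
        rw [lintegral_const_mul _ hmeas, hind, lintegral_indicator_one measurableSet_closedBall,
          Measure.restrict_apply measurableSet_closedBall, Set.inter_eq_left.2 hsub,
          Measure.addHaar_closedBall_center volume y]
    _ = ∫⁻ z in closedBall x (r + 1), ∫⁻ y in closedBall x r,
          ENNReal.ofReal |f y| * D.indicator 1 (z, y) := by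
        refine lintegral_lintegral_swap ?_
        refine (hg.comp_fst).mul ?_
        exact ((measurable_one.indicator hDm).comp measurable_swap).aemeasurable
    _ ≤ ∫⁻ _ in closedBall x (r + 1), ulNorm S f := by
        refine lintegral_mono fun z => ?_
        have hind : (fun y => ENNReal.ofReal |f y| * D.indicator (1 : _ × _ → ℝ≥0∞) (z, y)) =
            (closedBall z 1).indicator fun y => ENNReal.ofReal |f y| := by
          ext y
          simp [D, Set.indicator, mem_closedBall]
        dsimp only
        rw [hind, lintegral_indicator measurableSet_closedBall,
          Measure.restrict_restrict measurableSet_closedBall, Set.inter_comm]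
        exact (lintegral_mono_set (Set.inter_subset_inter_left _ hS)).trans
          (le_iSup (fun z => ∫⁻ y in S ∩ closedBall z 1, ENNReal.ofReal |f y|) z)
    _ = volume (closedBall x (r + 1)) * ulNorm S f := by
        rw [setLIntegral_const, mul_comm]

/-- The mean oscillation over a ball is at most twice the mean of the absolute value. -/
lemma mean_oscillation_le_two_mul {n : ℕ} (f : EuclideanSpace ℝ (Fin n) → ℝ)
    (x : EuclideanSpace ℝ (Fin n)) {r : ℝ} (hr : 0 < r) :
    (volume (closedBall x r))⁻¹ *
        ∫⁻ y in closedBall x r, ENNReal.ofReal |f y - ⨍ z in closedBall x r, f z| ≤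
      2 * ((volume (closedBall x r))⁻¹ * ∫⁻ y in closedBall x r, ENNReal.ofReal |f y|) := by
  set B := closedBall x r
  set c := ⨍ z in B, f z with hc
  have hB0 : volume B ≠ 0 := (measure_closedBall_pos volume x hr).ne'
  have hB : volume B ≠ ∞ := measure_closedBall_lt_top.ne
  have hcle : ENNReal.ofReal |c| ≤ (volume B)⁻¹ * ∫⁻ y in B, ENNReal.ofReal |f y| := by
    have h := enorm_integral_le_lintegral_enorm (μ := (volume.restrict B Set.univ)⁻¹ •
      volume.restrict B) f
    rw [lintegral_smul_measure, Measure.restrict_apply_univ] at h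
    simpa [hc, average, Real.enorm_eq_ofReal_abs] using h
  calc (volume B)⁻¹ * ∫⁻ y in B, ENNReal.ofReal |f y - c|
      ≤ (volume B)⁻¹ * ∫⁻ y in B, (ENNReal.ofReal |f y| + ENNReal.ofReal |c|) := by
        gcongr with y
        rw [← ENNReal.ofReal_add (abs_nonneg _) (abs_nonneg _)]
        exact ENNReal.ofReal_le_ofReal (abs_sub _ _)
    _ = (volume B)⁻¹ * (∫⁻ y in B, ENNReal.ofReal |f y|) + ENNReal.ofReal |c| := by
        rw [lintegral_add_right _ measurable_const, setLIntegral_const, mul_add,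
          mul_left_comm, ENNReal.inv_mul_cancel hB0 hB, mul_one]
    _ ≤ _ := by
        rw [two_mul]
        gcongr

/-- Enlarging the radius of a ball of radius at least `μ` by one multiplies its volume by a
bounded factor. -/
lemma volume_closedBall_add_one_le {n : ℕ} (x : EuclideanSpace ℝ (Fin n)) {μ r : ℝ}
    (hμ : 0 < μ) (hr : μ ≤ r) :
    volume (closedBall x (r + 1)) ≤
      ENNReal.ofReal (((μ + 1) / μ) ^ n) * volume (closedBall x r) := by
  have hr0 : 0 < r := hμ.trans_le hr
  rw [Measure.addHaar_closedBall _ x hr0.le, Measure.addHaar_closedBall _ x (by linarith),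
    ← mul_assoc, ← ENNReal.ofReal_mul (by positivity), finrank_euclideanSpace_fin, ← mul_pow]
  gcongr
  rw [div_mul_eq_mul_div, le_div_iff₀ hμ]
  nlinarith

/-- for finite `μ > 0`, the `BMO^∞(Ω)` seminorm is controlled by
`[f]_{BMO^μ(Ω)} + ‖f‖_{L¹_ul(Ω)}`, with a constant depending only on `n` and `μ`;
hence `bmo^∞_∞(Ω) = bmo^μ_∞(Ω)` with equivalent norms. -/
theorem bmo_infty_le_bmo_mu_add_ul (n : ℕ) (μ : ℝ) (hμ : 0 < μ) :
    ∃ C : ℝ, 0 < C ∧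
      ∀ (Ω : Set (EuclideanSpace ℝ (Fin n))), Ω.Nonempty → IsOpen Ω → IsConnected Ω →
        ∀ f : EuclideanSpace ℝ (Fin n) → ℝ, LocallyIntegrableOn f Ω →
          bmoSemi Ω ⊤ f ≤ ENNReal.ofReal C * (bmoSemi Ω (ENNReal.ofReal μ) f + ulNorm Ω f) := by
  set V := volume (closedBall (0 : EuclideanSpace ℝ (Fin n)) 1)
  have hV0 : V ≠ 0 := (measure_closedBall_pos volume _ one_pos).ne'
  have hV : V ≠ ∞ := measure_closedBall_lt_top.ne
  set K := ENNReal.ofReal (((μ + 1) / μ) ^ n) * V⁻¹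
  have hK : K ≠ ∞ := ENNReal.mul_ne_top ENNReal.ofReal_ne_top (ENNReal.inv_ne_top.2 hV0)
  refine ⟨1 + 2 * K.toReal, by positivity, fun Ω _ _ _ f hf => ?_⟩
  have hC : ENNReal.ofReal (1 + 2 * K.toReal) = 1 + 2 * K := by
    rw [ENNReal.ofReal_add zero_le_one (by positivity), ENNReal.ofReal_mul zero_le_two,
      ENNReal.ofReal_toReal hK]
    simp
  rw [hC]
  refine iSup_le fun x => iSup_le fun r => iSup_le fun hr => iSup_le fun _ => iSup_le fun hB => ?_
  rcases lt_or_ge r μ with hrμ | hrμ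
  · calc _ ≤ bmoSemi Ω (ENNReal.ofReal μ) f :=
          le_iSup_of_le x <| le_iSup_of_le r <| le_iSup_of_le hr <|
            le_iSup_of_le ((ENNReal.ofReal_lt_ofReal_iff hμ).2 hrμ) <| le_iSup_of_le hB le_rfl
      _ ≤ 1 * (bmoSemi Ω (ENNReal.ofReal μ) f + ulNorm Ω f) := by
          rw [one_mul]
          exact le_self_add
      _ ≤ _ := by
          gcongr
          exact le_self_add
  · have hfB : AEMeasurable f (volume.restrict (closedBall x r)) :=
      (hf.integrableOn_compact_subset hB (isCompact_closedBall x r)).aemeasurable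
    have hB0 : volume (closedBall x r) ≠ 0 := (measure_closedBall_pos volume x hr).ne'
    have hBt : volume (closedBall x r) ≠ ∞ := measure_closedBall_lt_top.ne
    have hmean : (volume (closedBall x r))⁻¹ * ∫⁻ y in closedBall x r, ENNReal.ofReal |f y| ≤
        K * ulNorm Ω f := by
      rw [mul_comm, ← div_eq_mul_inv, ENNReal.div_le_iff hB0 hBt]
      calc ∫⁻ y in closedBall x r, ENNReal.ofReal |f y|
          = (∫⁻ y in closedBall x r, ENNReal.ofReal |f y|) * V * V⁻¹ := by
            rw [mul_assoc, ENNReal.mul_inv_cancel hV0 hV, mul_one]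
        _ ≤ ENNReal.ofReal (((μ + 1) / μ) ^ n) * volume (closedBall x r) * ulNorm Ω f * V⁻¹ := by
            refine mul_le_mul_left ?_ V⁻¹
            refine (lintegral_closedBall_mul_volume_le Ω f x r hB hfB).trans ?_
            gcongr
            exact volume_closedBall_add_one_le x hμ hrμ
        _ = K * ulNorm Ω f * volume (closedBall x r) := by
            simp only [K]
            ring
    calc _ ≤ 2 * (K * ulNorm Ω f) :=
          (mean_oscillation_le_two_mul f x hr).trans (by gcongr)
      _ = (2 * K) * ulNorm Ω f := (mul_assoc _ _ _).symm
      _ ≤ _ := by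
          gcongr
          · exact le_add_self
          · exact le_add_self
end

section
/- Let Ω be a nonempty open connected proper subset of ℝⁿ and let 0 < ν₁ ≤ ν₂ ≤ δ ≤ ∞ with ν₁ < ∞. Then there exists a constant c > 0, depending only on n, ν₁, ν₂ and δ, such that [f]_{b^{ν₂}} ≤ [f]_{b^{ν₁}} + c·‖f‖_{L¹_ul(Γ_δ)} for every measurable f : Ω → ℝ with ‖f‖_{L¹_ul(Γ_δ)} < ∞. (In the paper this is applied with f = ∇d_Ω · v, the normal component of a vector field v, using only that |∇d_Ω·v| ≤ |v| pointwise.) -/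
open MeasureTheory Metric ENNReal

/-- The mass of a ball of radius `r` is controlled by the masses of unit balls, by averaging
over the centres of the unit balls meeting it. -/
theorem measure_closedBall_le_mul_iSup {n : ℕ} (ν : Measure (EuclideanSpace ℝ (Fin n))) [SFinite ν]
    (x : EuclideanSpace ℝ (Fin n)) {r : ℝ} (hr : 0 ≤ r) :
    ν (closedBall x r) ≤ ENNReal.ofReal ((r + 1) ^ n) * ⨆ z, ν (closedBall z 1) := by
  set V : ℝ≥0∞ := volume (ball (0 : EuclideanSpace ℝ (Fin n)) 1)
  have hV₀ : V ≠ 0 := (measure_ball_pos _ _ one_pos).ne'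
  have hV : V ≠ ⊤ := measure_ball_lt_top.ne
  set K := closedBall x (r + 1)
  have hmeas : MeasurableSet
      {p : EuclideanSpace ℝ (Fin n) × EuclideanSpace ℝ (Fin n) | dist p.1 p.2 ≤ 1} :=
    (isClosed_le continuous_dist continuous_const).measurableSet
  have hunit (y : EuclideanSpace ℝ (Fin n)) : volume (closedBall y 1) = V := by
    simp [Measure.addHaar_closedBall, V]
  have key : V * ν (closedBall x r) ≤
      V * (ENNReal.ofReal ((r + 1) ^ n) * ⨆ z, ν (closedBall z 1)) := calc
    V * ν (closedBall x r) = ∫⁻ _ in closedBall x r, V ∂ν := (setLIntegral_const _ _).symm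
    _ ≤ ∫⁻ y in closedBall x r, volume.restrict K (closedBall y 1) ∂ν := by
      refine setLIntegral_mono' measurableSet_closedBall fun y hy => ?_
      rw [Measure.restrict_apply measurableSet_closedBall, Set.inter_eq_left.2, hunit]
      refine closedBall_subset_closedBall' ?_
      linarith [mem_closedBall.1 hy]
    _ ≤ ∫⁻ y, volume.restrict K (closedBall y 1) ∂ν := setLIntegral_le_lintegral _ _
    _ = (volume.restrict K).prod ν {p | dist p.1 p.2 ≤ 1} :=
      (Measure.prod_apply_symm hmeas).symm
    _ = ∫⁻ z in K, ν (closedBall z 1) := by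
      rw [Measure.prod_apply hmeas]
      refine lintegral_congr fun z => congrArg ν ?_
      ext y
      simp [dist_comm]
    _ ≤ ∫⁻ _ in K, ⨆ z, ν (closedBall z 1) :=
      lintegral_mono fun z => le_iSup (fun z => ν (closedBall z 1)) z
    _ = V * (ENNReal.ofReal ((r + 1) ^ n) * ⨆ z, ν (closedBall z 1)) := by
      rw [setLIntegral_const, Measure.addHaar_closedBall _ _ (by linarith),
        finrank_euclideanSpace_fin]
      ring
  exact (ENNReal.mul_le_mul_iff_right hV₀ hV).1 key

theorem setLIntegral_closedBall_le_ulNorm {n : ℕ} (S : Set (EuclideanSpace ℝ (Fin n)))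
    (f : EuclideanSpace ℝ (Fin n) → ℝ)
    (x : EuclideanSpace ℝ (Fin n)) {r : ℝ} (hr : 0 ≤ r) :
    ∫⁻ y in S ∩ closedBall x r, ENNReal.ofReal |f y| ≤
      ENNReal.ofReal ((r + 1) ^ n) * ulNorm S f := by
  have hball (z : EuclideanSpace ℝ (Fin n)) (s : ℝ) :
      (volume.restrict S).withDensity (fun y => ENNReal.ofReal |f y|) (closedBall z s) =
        ∫⁻ y in S ∩ closedBall z s, ENNReal.ofReal |f y| := by
    rw [withDensity_apply _ measurableSet_closedBall,
      Measure.restrict_restrict measurableSet_closedBall, Set.inter_comm]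
  simpa only [hball, ulNorm] using measure_closedBall_le_mul_iSup
    ((volume.restrict S).withDensity fun y => ENNReal.ofReal |f y|) x hr

theorem inter_closedBall_subset_tub {n : ℕ} {Ω : Set (EuclideanSpace ℝ (Fin n))} {δ : ℝ≥0∞}
    {x : EuclideanSpace ℝ (Fin n)} (hx : x ∈ frontier Ω) {r : ℝ} (hr : ENNReal.ofReal r < δ) :
    Ω ∩ closedBall x r ⊆ tub Ω δ := fun _ hy =>
  ⟨hy.1, (ENNReal.ofReal_le_ofReal ((infDist_le_dist_of_mem hx).trans hy.2)).trans_lt hr⟩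

/-- for `0 < ν₁ ≤ ν₂ ≤ δ ≤ ∞` with `ν₁ < ∞`, one has
`[f]_{b^{ν₂}} ≤ [f]_{b^{ν₁}} + c ‖f‖_{L¹_ul(Γ_δ)}` with `c` depending only on
`n, ν₁, ν₂, δ`. -/
theorem bSemi_mono_exponent (n : ℕ) (ν₁ : ℝ) (ν₂ δ : ℝ≥0∞) (hν₁ : 0 < ν₁)
    (hν₁₂ : ENNReal.ofReal ν₁ ≤ ν₂) (hν₂δ : ν₂ ≤ δ) :
    ∃ c : ℝ, 0 < c ∧
      ∀ (Ω : Set (EuclideanSpace ℝ (Fin n))), Ω.Nonempty → IsOpen Ω → IsConnected Ω →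
        Ω ≠ Set.univ →
        ∀ f : EuclideanSpace ℝ (Fin n) → ℝ, Measurable f → ulNorm (tub Ω δ) f < ⊤ →
          bSemi Ω ν₂ f ≤ bSemi Ω (ENNReal.ofReal ν₁) f + ENNReal.ofReal c * ulNorm (tub Ω δ) f := by
  refine ⟨(1 + ν₁⁻¹) ^ n, by positivity, fun Ω _ _ _ _ f _ _ => ?_⟩
  refine iSup₂_le fun x hx => iSup₂_le fun r hr => iSup_le fun hrν => ?_
  rcases lt_or_ge r ν₁ with h | h
  · refine le_add_right ?_
    exact le_iSup₂_of_le x hx <| le_iSup₂_of_le r hr <|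
      le_iSup_of_le ((ENNReal.ofReal_lt_ofReal_iff hν₁).2 h) le_rfl
  · refine le_add_left ?_
    have hsub : Ω ∩ closedBall x r ⊆ tub Ω δ ∩ closedBall x r :=
      Set.subset_inter (inter_closedBall_subset_tub hx (hrν.trans_le hν₂δ)) Set.inter_subset_right
    calc
      _ ≤ (ENNReal.ofReal (r ^ n))⁻¹ *
          (ENNReal.ofReal ((r + 1) ^ n) * ulNorm (tub Ω δ) f) := by
        gcongr
        exact (lintegral_mono_set hsub).trans (setLIntegral_closedBall_le_ulNorm _ f x hr.le)
      _ = ENNReal.ofReal ((1 + r⁻¹) ^ n) * ulNorm (tub Ω δ) f := by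
        rw [← ENNReal.ofReal_inv_of_pos (by positivity), ← mul_assoc,
          ← ENNReal.ofReal_mul (by positivity), ← inv_pow, ← mul_pow, mul_add,
          inv_mul_cancel₀ hr.ne', mul_one]
      _ ≤ _ := by gcongr
end

section
/- Let Ω be a nonempty open connected proper subset of ℝⁿ, let μ, δ ∈ (0,∞] and 0 < ν₁ < ν₂ < ∞. Then there exists a constant C > 0, depending only on n, μ, δ, ν₁, ν₂ and Ω, such that for every measurable vector field v : Ω → ℝⁿ and every measurable u : Ω → ℝ with |u(x)| ≤ |v(x)| for a.e. x ∈ Ω, one has ‖v‖_{bmo^μ_δ(Ω)} + [u]_{b^{ν₂}} ≤ C·( ‖v‖_{bmo^μ_δ(Ω)} + [u]_{b^{ν₁}} ). (In the paper u = ∇d_Ω · v, so this gives the equivalence of the norms ‖·‖_{vbmo^{μ,ν₁}_δ} and ‖·‖_{vbmo^{μ,ν₂}_δ}.) -/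
open MeasureTheory Metric ENNReal

lemma IsPreconnected.inter_frontier_nonempty {X : Type*} [TopologicalSpace X] {s t : Set X}
    (ht : IsPreconnected t) (hts : (t ∩ s).Nonempty) (hts' : ¬t ⊆ s) :
    (t ∩ frontier s).Nonempty := by
  by_contra h
  have hfr : ∀ z ∈ t, z ∈ closure s → z ∈ interior s := fun z hz hzs => by
    by_contra hzi
    exact h ⟨z, hz, hzs, hzi⟩
  obtain ⟨p, hpt, hps⟩ := hts
  obtain ⟨a, hat, has⟩ := Set.not_subset.1 hts'
  obtain ⟨z, -, hzi, hzc⟩ := ht (interior s) (closure s)ᶜ isOpen_interior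
    isClosed_closure.isOpen_compl
    (fun z hz => or_iff_not_imp_right.2 fun hzc => hfr z hz (not_not.1 hzc))
    ⟨p, hpt, hfr p hpt (subset_closure hps)⟩
    ⟨a, hat, fun hac => has (interior_subset (hfr a hat hac))⟩
  exact hzc (interior_subset_closure hzi)

lemma ball_infDist_subset_or_disjoint {E : Type*} [NormedAddCommGroup E] [NormedSpace ℝ E]
    (s : Set E) (x : E) :
    ball x (infDist x (frontier s)) ⊆ s ∨ Disjoint (ball x (infDist x (frontier s))) s := by
  by_contra! h
  obtain ⟨hsub, hdis⟩ := h
  have hinter : (ball x (infDist x (frontier s)) ∩ s).Nonempty :=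
    Set.not_disjoint_iff_nonempty_inter.1 hdis
  have hpre : IsPreconnected (ball x (infDist x (frontier s))) :=
    (convex_ball x _).isPreconnected
  obtain ⟨z, hz, hzf⟩ := hpre.inter_frontier_nonempty hinter hsub
  have := infDist_le_dist_of_mem (x := x) hzf
  rw [mem_ball, dist_comm] at hz
  linarith

lemma exists_dist_eq_infDist_add_le {E : Type*} [NormedAddCommGroup E] [NormedSpace ℝ E]
    [ProperSpace E] {s : Set E} (hs : IsClosed s) (hne : s.Nonempty) (x : E) {ρ : ℝ}
    (hρ : 0 ≤ ρ) (hρx : ρ ≤ infDist x s) :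
    ∃ y, dist y x ≤ ρ ∧ infDist y s + ρ ≤ infDist x s := by
  obtain ⟨z, hz, hxz⟩ := hs.exists_infDist_eq_dist hne x
  rcases eq_or_lt_of_le (dist_nonneg (x := x) (y := z)) with h0 | h0
  · exact ⟨x, by simpa using hρ, by linarith⟩
  have ht : 0 ≤ ρ / dist x z := by positivity
  have ht1 : ρ / dist x z ≤ 1 := by rw [div_le_one h0]; linarith
  refine ⟨AffineMap.lineMap x z (ρ / dist x z), ?_, ?_⟩
  · rw [dist_lineMap_left, Real.norm_of_nonneg ht, div_mul_cancel₀ _ h0.ne']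
  · have h1 := infDist_le_dist_of_mem (x := AffineMap.lineMap x z (ρ / dist x z)) hz
    rw [dist_lineMap_right, Real.norm_of_nonneg (by linarith), sub_mul,
      div_mul_cancel₀ _ h0.ne'] at h1
    linarith

section

variable {n : ℕ} {Ω : Set (EuclideanSpace ℝ (Fin n))} {μ δ : ℝ≥0∞}
  {f : EuclideanSpace ℝ (Fin n) → ℝ}

lemma lintegral_sub_average_le_bmoSemi {x : EuclideanSpace ℝ (Fin n)} {r : ℝ} (hr : 0 < r)
    (hrμ : ENNReal.ofReal r < μ) (hsub : closedBall x r ⊆ Ω) :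
    ∫⁻ y in closedBall x r, ENNReal.ofReal |f y - ⨍ z in closedBall x r, f z| ≤
      volume (closedBall x r) * bmoSemi Ω μ f := by
  have h0 : volume (closedBall x r) ≠ 0 := (measure_closedBall_pos _ x hr).ne'
  have ht : volume (closedBall x r) ≠ ∞ := measure_closedBall_lt_top.ne
  rw [← ENNReal.inv_mul_le_iff h0 ht]
  exact le_iSup_of_le x <| le_iSup_of_le r <| le_iSup_of_le hr <| le_iSup_of_le hrμ <|
    le_iSup_of_le hsub le_rfl

lemma lintegral_closedBall_le_of_subset (hf : Measurable f) {x y : EuclideanSpace ℝ (Fin n)}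
    {r R : ℝ} (hr : 0 < r) (hR : 0 < R) (hRμ : ENNReal.ofReal R < μ)
    (hsub : closedBall x R ⊆ Ω) (hyx : closedBall y r ⊆ closedBall x R) :
    ∫⁻ z in closedBall x R, ENNReal.ofReal |f z| ≤
      volume (closedBall x R) * bmoSemi Ω μ f +
        volume (closedBall x R) / volume (closedBall y r) *
          (volume (closedBall x R) * bmoSemi Ω μ f +
            ∫⁻ z in closedBall y r, ENNReal.ofReal |f z|) := by
  set c := ⨍ z in closedBall x R, f z with hc
  have hosc := lintegral_sub_average_le_bmoSemi (f := f) hR hRμ hsub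
  rw [← hc] at hosc
  have h0 : volume (closedBall y r) ≠ 0 := (measure_closedBall_pos _ y hr).ne'
  have ht : volume (closedBall y r) ≠ ∞ := measure_closedBall_lt_top.ne
  have hlarge : ∫⁻ z in closedBall x R, ENNReal.ofReal |f z| ≤
      (∫⁻ z in closedBall x R, ENNReal.ofReal |f z - c|) +
        ENNReal.ofReal |c| * volume (closedBall x R) := by
    rw [← setLIntegral_const, ← lintegral_add_right _ measurable_const]
    refine lintegral_mono fun z => ?_
    rw [← ENNReal.ofReal_add (abs_nonneg _) (abs_nonneg _)]
    refine ENNReal.ofReal_le_ofReal ?_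
    simpa using abs_add_le (f z - c) c
  have hsmall : ENNReal.ofReal |c| * volume (closedBall y r) ≤
      (∫⁻ z in closedBall y r, ENNReal.ofReal |f z - c|) +
        ∫⁻ z in closedBall y r, ENNReal.ofReal |f z| := by
    rw [← setLIntegral_const, ← lintegral_add_right _ (by fun_prop)]
    refine lintegral_mono fun z => ?_
    rw [← ENNReal.ofReal_add (abs_nonneg _) (abs_nonneg _)]
    refine ENNReal.ofReal_le_ofReal ?_
    simpa [abs_sub_comm, add_comm] using abs_add_le (f z) (c - f z)
  have hmono := lintegral_mono_set (μ := volume) (f := fun z => ENNReal.ofReal |f z - c|) hyx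
  calc _ ≤ _ := hlarge
    _ = (∫⁻ z in closedBall x R, ENNReal.ofReal |f z - c|) +
        volume (closedBall x R) / volume (closedBall y r) *
          (ENNReal.ofReal |c| * volume (closedBall y r)) := by
      rw [mul_comm (ENNReal.ofReal |c|) (volume (closedBall y r)), ← mul_assoc,
        ENNReal.div_mul_cancel h0 ht, mul_comm (ENNReal.ofReal |c|)]
    _ ≤ _ := by
      gcongr
      exact hsmall.trans (by gcongr; exact hmono.trans hosc)

lemma lintegral_inter_closedBall_le_ulNorm {x : EuclideanSpace ℝ (Fin n)} {ρ : ℝ} (hρ1 : ρ ≤ 1)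
    (hd : ENNReal.ofReal (infDist x (frontier Ω) + ρ) < δ) :
    ∫⁻ y in Ω ∩ closedBall x ρ, ENNReal.ofReal |f y| ≤ ulNorm (tub Ω δ) f := by
  refine (lintegral_mono_set fun y hy => ?_).trans
    (le_iSup (fun x => ∫⁻ y in tub Ω δ ∩ closedBall x 1, ENNReal.ofReal |f y|) x)
  refine ⟨⟨hy.1, lt_of_le_of_lt (ENNReal.ofReal_le_ofReal ?_) hd⟩,
    closedBall_subset_closedBall hρ1 hy.2⟩
  exact infDist_le_infDist_add_dist.trans (by gcongr; exact hy.2)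

lemma exists_lintegral_inter_closedBall_le_of_infDist_le
    (hΩ : (frontier Ω).Nonempty) {ρ : ℝ} (hρ : 0 < ρ) (hρ1 : ρ ≤ 1)
    (hρμ : ENNReal.ofReal (2 * ρ) < μ) (hρδ : ENNReal.ofReal (5 * ρ) < δ) (k : ℕ) :
    ∃ C : ℝ≥0∞, C ≠ ∞ ∧ ∀ f : EuclideanSpace ℝ (Fin n) → ℝ, Measurable f →
      ∀ x, infDist x (frontier Ω) ≤ (4 + k) * ρ →
        ∫⁻ y in Ω ∩ closedBall x ρ, ENNReal.ofReal |f y| ≤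
          C * (bmoSemi Ω μ f + ulNorm (tub Ω δ) f) := by
  induction k with
  | zero =>
    refine ⟨1, one_ne_top, fun f _ x hx => ?_⟩
    rw [one_mul]
    refine (lintegral_inter_closedBall_le_ulNorm hρ1 (lt_of_le_of_lt ?_ hρδ)).trans le_add_self
    refine ENNReal.ofReal_le_ofReal ?_
    push_cast at hx
    linarith
  | succ k ih =>
    obtain ⟨C, hC, h⟩ := ih
    set V := volume (closedBall (0 : EuclideanSpace ℝ (Fin n)) (2 * ρ)) with hV
    set W := volume (closedBall (0 : EuclideanSpace ℝ (Fin n)) ρ) with hW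
    have hVt : V ≠ ∞ := measure_closedBall_lt_top.ne
    have hW0 : W ≠ 0 := (measure_closedBall_pos _ _ hρ).ne'
    have hq : V / W ≠ ∞ := ENNReal.div_ne_top hVt hW0
    refine ⟨C + (V + V / W * (V + C)), by finiteness, fun f hf x hx => ?_⟩
    rcases le_or_gt (infDist x (frontier Ω)) ((4 + k) * ρ) with hx' | hx'
    · exact (h f hf x hx').trans (by gcongr; exact le_self_add)
    have hk : (0 : ℝ) ≤ k * ρ := by positivity
    push_cast at hx
    have hball : closedBall x (2 * ρ) ⊆ ball x (infDist x (frontier Ω)) :=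
      closedBall_subset_ball (by linarith)
    have hρ2 : closedBall x ρ ⊆ closedBall x (2 * ρ) := closedBall_subset_closedBall (by linarith)
    rcases ball_infDist_subset_or_disjoint Ω x with hsub | hdis
    · obtain ⟨y, hyx, hy⟩ := exists_dist_eq_infDist_add_le isClosed_frontier hΩ x hρ.le (by linarith)
      have hyball : closedBall y ρ ⊆ closedBall x (2 * ρ) :=
        closedBall_subset_closedBall' (by linarith)
      have hstep := lintegral_closedBall_le_of_subset hf hρ (by positivity) hρμ
        (hball.trans hsub) hyball
      have hIH := h f hf y (by linarith)
      rw [Set.inter_eq_self_of_subset_right (hyball.trans (hball.trans hsub))] at hIH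
      rw [Measure.addHaar_closedBall_center, Measure.addHaar_closedBall_center volume y,
        ← hV, ← hW] at hstep
      calc _ ≤ ∫⁻ z in closedBall x (2 * ρ), ENNReal.ofReal |f z| :=
            lintegral_mono_set (Set.inter_subset_right.trans hρ2)
        _ ≤ _ := hstep
        _ ≤ V * (bmoSemi Ω μ f + ulNorm (tub Ω δ) f) +
            V / W * (V * (bmoSemi Ω μ f + ulNorm (tub Ω δ) f) +
              C * (bmoSemi Ω μ f + ulNorm (tub Ω δ) f)) := by
          gcongr <;> exact le_self_add
        _ = (V + V / W * (V + C)) * (bmoSemi Ω μ f + ulNorm (tub Ω δ) f) := by ring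
        _ ≤ (C + (V + V / W * (V + C))) * (bmoSemi Ω μ f + ulNorm (tub Ω δ) f) :=
          mul_le_mul' le_add_self le_rfl
    · rw [((hdis.mono_left (hρ2.trans hball)).symm).inter_eq]
      simp

lemma exists_lintegral_inter_closedBall_le (hΩ : (frontier Ω).Nonempty) (hμ : 0 < μ)
    (hδ : 0 < δ) (R : ℝ) :
    ∃ C : ℝ≥0∞, C ≠ ∞ ∧ ∀ f : EuclideanSpace ℝ (Fin n) → ℝ, Measurable f →
      ∀ x ∈ frontier Ω, ∫⁻ y in Ω ∩ closedBall x R, ENNReal.ofReal |f y| ≤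
        C * (bmoSemi Ω μ f + ulNorm (tub Ω δ) f) := by
  obtain ⟨a, ha0, ha⟩ := ENNReal.lt_iff_exists_nnreal_btwn.1
    (lt_min (lt_min hμ hδ) (zero_lt_one' ℝ≥0∞))
  have ha0' : (0 : ℝ) < a := by exact_mod_cast ha0
  have hamin := lt_min_iff.1 ha
  have ha1 : (a : ℝ) < 1 := by exact_mod_cast hamin.2
  obtain ⟨haμ, haδ⟩ := lt_min_iff.1 hamin.1
  rw [← ENNReal.ofReal_coe_nnreal] at haμ haδ
  set ρ : ℝ := a / 5 with hρ
  have hρ0 : 0 < ρ := by positivity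
  obtain ⟨k, hk⟩ := exists_nat_ge (R / ρ)
  rw [div_le_iff₀ hρ0] at hk
  obtain ⟨C, hC, h⟩ := exists_lintegral_inter_closedBall_le_of_infDist_le hΩ hρ0 (by linarith)
    (lt_of_le_of_lt (ENNReal.ofReal_le_ofReal (by linarith)) haμ)
    (lt_of_le_of_lt (ENNReal.ofReal_le_ofReal (by linarith)) haδ) k
  obtain ⟨t, htR, htfin, ht⟩ := finite_cover_balls_of_compact
    (isCompact_closedBall (0 : EuclideanSpace ℝ (Fin n)) R) hρ0
  lift t to Finset (EuclideanSpace ℝ (Fin n)) using htfin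
  refine ⟨t.card * C, by finiteness, fun f hf x hx => ?_⟩
  have hcover : Ω ∩ closedBall x R ⊆ ⋃ c : t, Ω ∩ closedBall (x + c) ρ := by
    rintro y ⟨hyΩ, hy⟩
    have : y - x ∈ closedBall (0 : EuclideanSpace ℝ (Fin n)) R := by
      rwa [mem_closedBall_zero_iff, ← dist_eq_norm]
    obtain ⟨c, hc, hyc⟩ := Set.mem_iUnion₂.1 (ht this)
    refine Set.mem_iUnion.2 ⟨⟨c, hc⟩, hyΩ, ?_⟩
    rw [mem_ball, dist_eq_norm, sub_sub] at hyc
    rw [mem_closedBall, dist_eq_norm]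
    exact hyc.le
  calc _ ≤ ∫⁻ y in ⋃ c : t, Ω ∩ closedBall (x + c) ρ, ENNReal.ofReal |f y| :=
        lintegral_mono_set hcover
    _ ≤ ∑ c : t, ∫⁻ y in Ω ∩ closedBall (x + c) ρ, ENNReal.ofReal |f y| := by
      simpa only [tsum_fintype] using lintegral_iUnion_le
        (fun c : t => Ω ∩ closedBall (x + c) ρ) fun y => ENNReal.ofReal |f y|
    _ ≤ ∑ _c : t, C * (bmoSemi Ω μ f + ulNorm (tub Ω δ) f) := by
      refine Finset.sum_le_sum fun c _ => h f hf _ ?_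
      refine (infDist_le_dist_of_mem hx).trans ?_
      have := htR c.2
      rw [mem_closedBall_zero_iff] at this
      simp only [dist_self_add_left]
      linarith
    _ = _ := by rw [Finset.sum_const, Finset.card_univ, Fintype.card_coe, nsmul_eq_mul, mul_assoc]

lemma setLIntegral_abs_le_sum {s : Set (EuclideanSpace ℝ (Fin n))}
    {v : EuclideanSpace ℝ (Fin n) → EuclideanSpace ℝ (Fin n)}
    {u : EuclideanSpace ℝ (Fin n) → ℝ} (hv : Measurable v)
    (huv : ∀ᵐ x ∂(volume.restrict s), |u x| ≤ ‖v x‖) :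
    ∫⁻ x in s, ENNReal.ofReal |u x| ≤ ∑ i, ∫⁻ x in s, ENNReal.ofReal |v x i| := by
  rw [← lintegral_finsetSum _ fun i _ => by fun_prop]
  refine lintegral_mono_ae (huv.mono fun x hx => ?_)
  rw [← ENNReal.ofReal_sum_of_nonneg fun i _ => abs_nonneg _]
  refine ENNReal.ofReal_le_ofReal (hx.trans ?_)
  rw [EuclideanSpace.norm_eq]
  simpa using Real.sqrt_le_iff.2 ⟨Finset.sum_nonneg fun i _ => abs_nonneg (v x i),
    Finset.sum_sq_le_sq_sum_of_nonneg fun i _ => abs_nonneg (v x i)⟩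

lemma bSemi_le_add {ν₁ ν₂ : ℝ} (hν₁ : 0 < ν₁) {A : ℝ≥0∞} {u : EuclideanSpace ℝ (Fin n) → ℝ}
    (hA : ∀ x ∈ frontier Ω, ∫⁻ y in Ω ∩ closedBall x ν₂, ENNReal.ofReal |u y| ≤ A) :
    bSemi Ω (ENNReal.ofReal ν₂) u ≤
      (ENNReal.ofReal (ν₁ ^ n))⁻¹ * A + bSemi Ω (ENNReal.ofReal ν₁) u := by
  refine iSup_le fun x => iSup_le fun hx => iSup_le fun r => iSup_le fun hr => iSup_le fun hr₂ => ?_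
  rcases lt_or_ge r ν₁ with h | h
  · refine le_add_left ?_
    exact le_iSup_of_le x <| le_iSup_of_le hx <| le_iSup_of_le r <| le_iSup_of_le hr <|
      le_iSup_of_le ((ENNReal.ofReal_lt_ofReal_iff hν₁).2 h) le_rfl
  · refine le_add_right ?_
    gcongr
    refine (lintegral_mono_set ?_).trans (hA x hx)
    gcongr
    exact (ENNReal.ofReal_lt_ofReal_iff'.1 hr₂).1.le

end

/-- equivalence of the `vbmo^{μ,ν₁}_δ` and `vbmo^{μ,ν₂}_δ` norms, for
`0 < ν₁ < ν₂ < ∞`, where `u` plays the role of the normal component `∇d_Ω · v`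
(one only uses `|u| ≤ |v|` a.e.). -/
theorem vbmo_norm_equiv (n : ℕ) (μ δ : ℝ≥0∞) (hμ : 0 < μ) (hδ : 0 < δ)
    (ν₁ ν₂ : ℝ) (hν₁ : 0 < ν₁) (hν : ν₁ < ν₂)
    (Ω : Set (EuclideanSpace ℝ (Fin n))) (hne : Ω.Nonempty) (hop : IsOpen Ω)
    (hconn : IsConnected Ω) (hproper : Ω ≠ Set.univ) :
    ∃ C : ℝ, 0 < C ∧
      ∀ (v : EuclideanSpace ℝ (Fin n) → EuclideanSpace ℝ (Fin n))
        (u : EuclideanSpace ℝ (Fin n) → ℝ), Measurable v → Measurable u →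
        (∀ᵐ x ∂(volume.restrict Ω), |u x| ≤ ‖v x‖) →
        (∑ i : Fin n, (bmoSemi Ω μ (fun x => v x i) + ulNorm (tub Ω δ) (fun x => v x i)))
            + bSemi Ω (ENNReal.ofReal ν₂) u ≤
          ENNReal.ofReal C *
            ((∑ i : Fin n, (bmoSemi Ω μ (fun x => v x i) + ulNorm (tub Ω δ) (fun x => v x i)))
              + bSemi Ω (ENNReal.ofReal ν₁) u) := by
  have hΩ : (frontier Ω).Nonempty := nonempty_frontier_iff.2 ⟨hne, hproper⟩
  obtain ⟨C, hC, h⟩ := exists_lintegral_inter_closedBall_le hΩ hμ hδ ν₂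
  set K := (ENNReal.ofReal (ν₁ ^ n))⁻¹ * C with hK
  have hKt : K ≠ ∞ := ENNReal.mul_ne_top
    (ENNReal.inv_ne_top.2 (ENNReal.ofReal_pos.2 (pow_pos hν₁ n)).ne') hC
  refine ⟨1 + K.toReal, by positivity, fun v u hv _ huv => ?_⟩
  rw [ENNReal.ofReal_add zero_le_one toReal_nonneg, ENNReal.ofReal_one, ENNReal.ofReal_toReal hKt]
  set S := ∑ i : Fin n, (bmoSemi Ω μ (fun x => v x i) + ulNorm (tub Ω δ) (fun x => v x i)) with hS
  have hu : ∀ x ∈ frontier Ω, ∫⁻ y in Ω ∩ closedBall x ν₂, ENNReal.ofReal |u y| ≤ C * S := by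
    intro x hx
    refine (setLIntegral_abs_le_sum hv
      (ae_restrict_of_ae_restrict_of_subset Set.inter_subset_left huv)).trans ?_
    rw [hS, Finset.mul_sum]
    exact Finset.sum_le_sum fun i _ => h _ (by fun_prop) x hx
  calc S + bSemi Ω (ENNReal.ofReal ν₂) u
      ≤ S + ((ENNReal.ofReal (ν₁ ^ n))⁻¹ * (C * S) + bSemi Ω (ENNReal.ofReal ν₁) u) := by
        gcongr
        exact bSemi_le_add hν₁ hu
    _ = (1 + K) * S + 1 * bSemi Ω (ENNReal.ofReal ν₁) u := by rw [hK]; ring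
    _ ≤ (1 + K) * (S + bSemi Ω (ENNReal.ofReal ν₁) u) := by
        rw [mul_add]
        gcongr
        exact le_self_add
end

section
/- Let Ψ : ℝⁿ → ℝⁿ be a bijection such that both Ψ and Ψ⁻¹ are Lipschitz with Lipschitz constant at most L. Then there exists a constant C > 0, depending only on n and L, such that ‖f ∘ Ψ‖_{bmo} ≤ C·‖f‖_{bmo} for every f ∈ L¹_loc(ℝⁿ), where ‖f‖_{bmo} := [f]_{BMO^∞(ℝⁿ)} + ‖f‖_{L¹_ul(ℝⁿ)}. In particular the space bmo(ℝⁿ) is invariant under bi-Lipschitz coordinate changes. -/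
open MeasureTheory Metric ENNReal

/-- A homeomorphism of `ℝⁿ` with `K`-Lipschitz inverse increases preimage volumes by a factor at
most `K ^ n`. -/
theorem map_volume_le_of_lipschitz_symm {n : ℕ}
    (e : EuclideanSpace ℝ (Fin n) ≃ₜ EuclideanSpace ℝ (Fin n)) {K : NNReal}
    (hK : LipschitzWith K e.symm) :
    (volume : Measure (EuclideanSpace ℝ (Fin n))).map e ≤ ((K : ℝ≥0∞) ^ n) • volume := by
  have hvol : (volume : Measure (EuclideanSpace ℝ (Fin n))) =
      Measure.addHaarScalarFactor volume (Measure.hausdorffMeasure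
        (Module.finrank ℝ (EuclideanSpace ℝ (Fin n)) : ℝ)) •
      Measure.hausdorffMeasure (Module.finrank ℝ (EuclideanSpace ℝ (Fin n)) : ℝ) :=
    Measure.isAddLeftInvariant_eq_smul _ _
  refine Measure.le_iff.2 fun s _ => ?_
  rw [e.measurableEmbedding.map_apply, Measure.smul_apply, ← e.image_symm, hvol]
  simp only [Measure.smul_apply, finrank_euclideanSpace_fin, smul_eq_mul, ENNReal.smul_def]
  have h := hK.hausdorffMeasure_image_le (d := (n : ℝ)) (Nat.cast_nonneg n) s
  rw [ENNReal.rpow_natCast] at h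
  rw [mul_left_comm]
  gcongr

/-- Change of variables bound for a set mapped into another one. -/
theorem setLIntegral_comp_le_of_lipschitz_symm {n : ℕ}
    (e : EuclideanSpace ℝ (Fin n) ≃ₜ EuclideanSpace ℝ (Fin n)) {K : NNReal}
    (hK : LipschitzWith K e.symm) {A B : Set (EuclideanSpace ℝ (Fin n))} (hAB : Set.MapsTo e A B)
    (h : EuclideanSpace ℝ (Fin n) → ℝ≥0∞) :
    ∫⁻ y in A, h (e y) ≤ (K : ℝ≥0∞) ^ n * ∫⁻ y in B, h y := by
  calc ∫⁻ y in A, h (e y) ≤ ∫⁻ y in e ⁻¹' B, h (e y) := lintegral_mono_set hAB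
    _ = ∫⁻ y in B, h y ∂(volume.map e) := by
      rw [e.measurableEmbedding.restrict_map, e.measurableEmbedding.lintegral_map]
    _ ≤ ∫⁻ y in B, h y ∂(((K : ℝ≥0∞) ^ n) • volume) :=
      lintegral_mono' (Measure.restrict_mono le_rfl (map_volume_le_of_lipschitz_symm e hK)) le_rfl
    _ = (K : ℝ≥0∞) ^ n * ∫⁻ y in B, h y := by
      rw [Measure.restrict_smul, lintegral_smul_measure, smul_eq_mul]

theorem integrableOn_comp_of_lipschitz_symm {n : ℕ}
    (e : EuclideanSpace ℝ (Fin n) ≃ₜ EuclideanSpace ℝ (Fin n)) {K : NNReal}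
    (hK : LipschitzWith K e.symm) {A B : Set (EuclideanSpace ℝ (Fin n))} (hAB : Set.MapsTo e A B)
    {f : EuclideanSpace ℝ (Fin n) → ℝ} (hf : IntegrableOn f B) :
    IntegrableOn (f ∘ e) A := by
  have h1 : IntegrableOn f B (((K : ℝ≥0∞) ^ n) • volume) := by
    rw [IntegrableOn, Measure.restrict_smul]
    exact Integrable.smul_measure hf (by finiteness)
  have h2 : IntegrableOn f B (volume.map e) :=
    h1.mono_measure (map_volume_le_of_lipschitz_symm e hK)
  exact (e.measurableEmbedding.integrableOn_map_iff.1 h2).mono_set hAB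

/-- The mean oscillation is at most twice the mean distance to any constant. -/
theorem setLIntegral_abs_sub_average_le {α : Type*} [MeasurableSpace α] {μ : Measure α}
    {A : Set α} {g : α → ℝ} (hA : μ A ≠ ∞) (hg : IntegrableOn g A μ) (c : ℝ) :
    ∫⁻ y in A, ENNReal.ofReal |g y - ⨍ z in A, g z ∂μ| ∂μ ≤
      2 * ∫⁻ y in A, ENNReal.ofReal |g y - c| ∂μ := by
  rcases eq_or_ne (μ A) 0 with h0 | h0
  · simp [Measure.restrict_eq_zero.2 h0]
  have hc : IntegrableOn (fun _ => c) A μ := integrableOn_const hA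
  have havg : (⨍ z in A, g z ∂μ) - c = ⨍ z in A, (g z - c) ∂μ := by
    have hpos : 0 < μ.real A := ENNReal.toReal_pos h0 hA
    rw [setAverage_eq, setAverage_eq, integral_sub hg hc, setIntegral_const, smul_sub,
      inv_smul_smul₀ hpos.ne']
  have hmean : μ A * ENNReal.ofReal |c - ⨍ z in A, g z ∂μ| ≤
      ∫⁻ y in A, ENNReal.ofReal |g y - c| ∂μ := by
    have hint : Integrable (fun y => |g y - c|) (μ.restrict A) := (hg.sub hc).abs
    rw [← abs_neg, neg_sub, havg, setAverage_eq, ← ofReal_integral_eq_lintegral_ofReal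
      hint (ae_of_all _ fun _ => abs_nonneg _), smul_eq_mul, abs_mul, abs_inv,
      abs_of_nonneg measureReal_nonneg, ← ENNReal.ofReal_toReal hA,
      ← ENNReal.ofReal_mul ENNReal.toReal_nonneg]
    have hpos : 0 < μ.real A := ENNReal.toReal_pos h0 hA
    refine ENNReal.ofReal_le_ofReal ?_
    change μ.real A * _ ≤ _
    rw [mul_inv_cancel_left₀ hpos.ne']
    exact abs_integral_le_integral_abs
  calc ∫⁻ y in A, ENNReal.ofReal |g y - ⨍ z in A, g z ∂μ| ∂μ
      ≤ ∫⁻ y in A, (ENNReal.ofReal |g y - c| + ENNReal.ofReal |c - ⨍ z in A, g z ∂μ|) ∂μ := by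
        refine lintegral_mono fun y => ?_
        rw [← ENNReal.ofReal_add (abs_nonneg _) (abs_nonneg _)]
        exact ENNReal.ofReal_le_ofReal (abs_sub_le _ _ _)
    _ = ∫⁻ y in A, ENNReal.ofReal |g y - c| ∂μ +
        μ A * ENNReal.ofReal |c - ⨍ z in A, g z ∂μ| := by
        rw [lintegral_add_right _ measurable_const, setLIntegral_const, mul_comm]
    _ ≤ 2 * ∫⁻ y in A, ENNReal.ofReal |g y - c| ∂μ := by
        rw [two_mul]
        gcongr

theorem volume_closedBall_mul {n : ℕ} (x y : EuclideanSpace ℝ (Fin n)) {K r : ℝ} (hK : 0 ≤ K)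
    (hr : 0 ≤ r) : volume (closedBall x (K * r)) = ENNReal.ofReal K ^ n * volume (closedBall y r) := by
  rw [Measure.addHaar_closedBall_mul volume x hK hr, finrank_euclideanSpace_fin,
    ENNReal.ofReal_pow hK, Measure.addHaar_closedBall_center volume y]

theorem bmoSemi_comp_le {n : ℕ} (e : EuclideanSpace ℝ (Fin n) ≃ₜ EuclideanSpace ℝ (Fin n))
    {K : NNReal} (hK0 : 0 < K) (hK : LipschitzWith K e) (hK' : LipschitzWith K e.symm)
    {f : EuclideanSpace ℝ (Fin n) → ℝ} (hf : LocallyIntegrable f) :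
    bmoSemi Set.univ ⊤ (f ∘ e) ≤ 2 * ((K : ℝ≥0∞) ^ n * (K : ℝ≥0∞) ^ n) *
      bmoSemi Set.univ ⊤ f := by
  refine iSup_le fun x => iSup_le fun r => iSup_le fun hr => iSup_le fun _ => iSup_le fun _ => ?_
  have hmaps := hK.mapsTo_closedBall x r
  have hint := integrableOn_comp_of_lipschitz_symm e hK' hmaps
    (hf.integrableOn_isCompact (isCompact_closedBall (e x) (K * r)))
  set c := ⨍ z in closedBall (e x) (K * r), f z
  have hKr : 0 < (K : ℝ) * r := mul_pos hK0 hr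
  have hosc : (volume (closedBall (e x) (K * r)))⁻¹ *
      ∫⁻ y in closedBall (e x) (K * r), ENNReal.ofReal |f y - c| ≤ bmoSemi Set.univ ⊤ f :=
    le_iSup_of_le (e x) <| le_iSup_of_le (K * r) <| le_iSup_of_le hKr <|
      le_iSup_of_le ENNReal.ofReal_lt_top <| le_iSup_of_le (Set.subset_univ _) le_rfl
  have hv (z : EuclideanSpace ℝ (Fin n)) {ρ : ℝ} (hρ : 0 < ρ) : volume (closedBall z ρ) ≠ 0 :=
    (measure_closedBall_pos volume z hρ).ne'
  have hv' (z : EuclideanSpace ℝ (Fin n)) (ρ : ℝ) : volume (closedBall z ρ) ≠ ∞ :=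
    measure_closedBall_lt_top.ne
  rw [mul_comm, ← div_eq_mul_inv, ENNReal.div_le_iff (hv _ hKr) (hv' _ _),
    volume_closedBall_mul (e x) x K.coe_nonneg hr.le, ENNReal.ofReal_coe_nnreal] at hosc
  rw [mul_comm (_⁻¹), ← div_eq_mul_inv, ENNReal.div_le_iff (hv _ hr) (hv' _ _)]
  calc ∫⁻ y in closedBall x r, ENNReal.ofReal |(f ∘ e) y - ⨍ z in closedBall x r, (f ∘ e) z|
      ≤ 2 * ∫⁻ y in closedBall x r, ENNReal.ofReal |(f ∘ e) y - c| :=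
        setLIntegral_abs_sub_average_le (hv' _ _) hint c
    _ ≤ 2 * ((K : ℝ≥0∞) ^ n * ∫⁻ y in closedBall (e x) (K * r), ENNReal.ofReal |f y - c|) := by
        gcongr
        exact setLIntegral_comp_le_of_lipschitz_symm e hK' hmaps fun y => ENNReal.ofReal |f y - c|
    _ ≤ 2 * ((K : ℝ≥0∞) ^ n *
        (bmoSemi Set.univ ⊤ f * ((K : ℝ≥0∞) ^ n * volume (closedBall x r)))) := by gcongr
    _ = _ := by ring

/-- The integral of `|f|` over any ball of radius `R` is controlled by the uniformly local norm. -/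
theorem exists_setLIntegral_closedBall_le_ulNorm (n : ℕ) (R : ℝ) :
    ∃ N : ℕ, ∀ (f : EuclideanSpace ℝ (Fin n) → ℝ) (x : EuclideanSpace ℝ (Fin n)),
      ∫⁻ y in closedBall x R, ENNReal.ofReal |f y| ≤ N * ulNorm Set.univ f := by
  obtain ⟨t, -, ht, hcover⟩ := finite_cover_balls_of_compact
    (isCompact_closedBall (0 : EuclideanSpace ℝ (Fin n)) R) one_pos
  lift t to Finset (EuclideanSpace ℝ (Fin n)) using ht
  refine ⟨t.card, fun f x => ?_⟩
  have hsub : closedBall x R ⊆ ⋃ z : t, closedBall (x + z) 1 := by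
    intro y hy
    have hy' : y - x ∈ closedBall (0 : EuclideanSpace ℝ (Fin n)) R := by
      simpa [dist_eq_norm] using hy
    obtain ⟨z, hz, hyz⟩ := Set.mem_iUnion₂.1 (hcover hy')
    refine Set.mem_iUnion.2 ⟨⟨z, hz⟩, ?_⟩
    rw [mem_ball, dist_eq_norm] at hyz
    rw [mem_closedBall, dist_eq_norm, ← sub_sub]
    exact hyz.le
  calc ∫⁻ y in closedBall x R, ENNReal.ofReal |f y|
      ≤ ∫⁻ y in ⋃ z : t, closedBall (x + z) 1, ENNReal.ofReal |f y| := lintegral_mono_set hsub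
    _ ≤ ∑ z : t, ∫⁻ y in closedBall (x + z) 1, ENNReal.ofReal |f y| := by
        rw [← tsum_fintype (L := .unconditional t)]
        exact lintegral_iUnion_le _ _
    _ ≤ ∑ _z : t, ulNorm Set.univ f := by
        refine Finset.sum_le_sum fun z _ => le_iSup_of_le (x + z) ?_
        rw [Set.univ_inter]
    _ = t.card * ulNorm Set.univ f := by
        rw [Finset.sum_const, nsmul_eq_mul, Finset.card_univ, Fintype.card_coe]

/-- `bmo(ℝⁿ)` is invariant under bi-Lipschitz coordinate changes:
if `Ψ` is a bijection with `Ψ` and `Ψ⁻¹` both `L`-Lipschitz, then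
`‖f ∘ Ψ‖_{bmo} ≤ C ‖f‖_{bmo}` with `C = C(n, L)`. -/
theorem bmo_biLipschitz_invariant (n : ℕ) (L : NNReal) :
    ∃ C : ℝ, 0 < C ∧
      ∀ Ψ : EuclideanSpace ℝ (Fin n) → EuclideanSpace ℝ (Fin n),
        Function.Bijective Ψ → LipschitzWith L Ψ → LipschitzWith L (Function.invFun Ψ) →
        ∀ f : EuclideanSpace ℝ (Fin n) → ℝ, LocallyIntegrable f →
          bmoSemi Set.univ ⊤ (f ∘ Ψ) + ulNorm Set.univ (f ∘ Ψ) ≤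
            ENNReal.ofReal C * (bmoSemi Set.univ ⊤ f + ulNorm Set.univ f) := by
  set K : NNReal := L + 1
  have hLK : L ≤ K := le_self_add
  have hK0 : 0 < K := by positivity
  obtain ⟨N, hN⟩ := exists_setLIntegral_closedBall_le_ulNorm n (K * 1)
  refine ⟨((2 * (K ^ n * K ^ n) + K ^ n * N : NNReal) : ℝ), by positivity,
    fun Ψ hΨ hL hL' f hf => ?_⟩
  let e : EuclideanSpace ℝ (Fin n) ≃ₜ EuclideanSpace ℝ (Fin n) :=
    { toFun := Ψ
      invFun := Function.invFun Ψ
      left_inv := Function.leftInverse_invFun hΨ.1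
      right_inv := Function.rightInverse_invFun hΨ.2
      continuous_toFun := hL.continuous
      continuous_invFun := hL'.continuous }
  have he : LipschitzWith K e := hL.weaken hLK
  have he' : LipschitzWith K e.symm := hL'.weaken hLK
  have hul : ulNorm Set.univ (f ∘ e) ≤ (K : ℝ≥0∞) ^ n * N * ulNorm Set.univ f := by
    refine iSup_le fun x => ?_
    rw [Set.univ_inter, mul_assoc]
    exact (setLIntegral_comp_le_of_lipschitz_symm e he' (he.mapsTo_closedBall x 1)
      fun y => ENNReal.ofReal |f y|).trans (mul_le_mul_right (hN f (e x)) _)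
  rw [ENNReal.ofReal_coe_nnreal, mul_add]
  push_cast
  refine add_le_add ((bmoSemi_comp_le e hK0 he he' hf).trans ?_) (hul.trans ?_)
  · gcongr
    exact le_self_add
  · gcongr
    exact le_add_self
end

section
/- Let Ω = (0,1) ⊂ ℝ and f(x) = log x. Then f ∈ L¹(0,1) (indeed ∫₀¹ |log x| dx = 1) and [f]_{BMO^∞((0,1))} < ∞, while [f]_{b^ν} = ∞ for every ν ∈ (0,∞]. Consequently, for every μ ∈ (0,∞] and ν ∈ (0,∞), f belongs to bmo^μ_ν((0,1)) but not to BMO_b^{μ,ν}((0,1)); hence the inclusion BMO_b^{μ,ν}(Ω) ⊆ bmo^μ_ν(Ω) is strict in general, even for bounded Ω. -/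
open MeasureTheory Metric ENNReal

/-- The `BMO^μ(Ω)` seminorm for `Ω ⊆ ℝ` (balls are intervals). -/
noncomputable def bmoSemiR (Ω : Set ℝ) (μ : ℝ≥0∞) (f : ℝ → ℝ) : ℝ≥0∞ :=
  ⨆ (x : ℝ) (r : ℝ) (_ : 0 < r) (_ : ENNReal.ofReal r < μ) (_ : closedBall x r ⊆ Ω),
    (volume (closedBall x r))⁻¹ *
      ∫⁻ y in closedBall x r, ENNReal.ofReal |f y - ⨍ z in closedBall x r, f z|

/-- The uniformly local `L¹` norm over a set `S ⊆ ℝ` (with ball radius `1`). -/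
noncomputable def ulNormR (S : Set ℝ) (f : ℝ → ℝ) : ℝ≥0∞ :=
  ⨆ x : ℝ, ∫⁻ y in S ∩ closedBall x 1, ENNReal.ofReal |f y|

/-- The boundary seminorm `[f]_{b^ν}` for `Ω ⊆ ℝ` (so with weight `r⁻¹`). -/
noncomputable def bSemiR (Ω : Set ℝ) (ν : ℝ≥0∞) (f : ℝ → ℝ) : ℝ≥0∞ :=
  ⨆ (x : ℝ) (_ : x ∈ frontier Ω) (r : ℝ) (_ : 0 < r) (_ : ENNReal.ofReal r < ν),
    (ENNReal.ofReal r)⁻¹ * ∫⁻ y in Ω ∩ closedBall x r, ENNReal.ofReal |f y|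

/-- The tubular neighborhood `Γ_δ = {x ∈ Ω | d_Ω(x) < δ}` of the boundary inside `Ω ⊆ ℝ`. -/
def tubR (Ω : Set ℝ) (δ : ℝ≥0∞) : Set ℝ :=
  {x ∈ Ω | ENNReal.ofReal (Metric.infDist x (frontier Ω)) < δ}

open Set in
/-- The mean of `log b - log` over `[a, b]` is at most `1`. -/
theorem integral_log_sub_log_le {a b : ℝ} (ha : 0 < a) (hab : a ≤ b) :
    ∫ y in Icc a b, (Real.log b - Real.log y) ≤ b - a := by
  rw [integral_Icc_eq_integral_Ioc, ← intervalIntegral.integral_of_le hab,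
    intervalIntegral.integral_sub intervalIntegrable_const intervalIntegral.intervalIntegrable_log',
    intervalIntegral.integral_const, integral_log, smul_eq_mul]
  nlinarith [Real.log_le_log ha hab]

open Set in
/-- The mean oscillation of `log` over `[a, b]` is at most `2`. -/
theorem integral_abs_log_sub_average_le {a b : ℝ} (ha : 0 < a) (hab : a < b) :
    ∫ y in Icc a b, |Real.log y - ⨍ z in Icc a b, Real.log z| ≤ 2 * (b - a) := by
  have hlog : IntegrableOn Real.log (Icc a b) :=
    (Real.continuousOn_log.mono fun y hy => (ha.trans_le hy.1).ne').integrableOn_Icc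
  have hc (c : ℝ) : IntegrableOn (fun _ : ℝ => c) (Icc a b) := continuousOn_const.integrableOn_Icc
  have hvol : (volume : Measure ℝ).real (Icc a b) = b - a := by
    simp [Measure.real, hab.le]
  have hle := integral_log_sub_log_le ha hab.le
  set m := ⨍ z in Icc a b, Real.log z with hm
  have hmean : (b - a) * m = ∫ z in Icc a b, Real.log z := by
    rw [hm, setAverage_eq, hvol, smul_eq_mul, mul_inv_cancel_left₀ (sub_pos.2 hab).ne']
  have hsub : ∫ y in Icc a b, (Real.log b - Real.log y) = (b - a) * (Real.log b - m) := by
    rw [integral_sub (hc _) hlog, setIntegral_const, hvol, ← hmean, smul_eq_mul]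
    ring
  have hnonneg : ∀ y ∈ Icc a b, 0 ≤ Real.log b - Real.log y := fun y hy =>
    sub_nonneg.2 (Real.log_le_log (ha.trans_le hy.1) hy.2)
  have hmb : 0 ≤ Real.log b - m := by
    have := setIntegral_nonneg measurableSet_Icc hnonneg (μ := volume)
    rw [hsub] at this
    exact nonneg_of_mul_nonneg_right this (sub_pos.2 hab)
  calc ∫ y in Icc a b, |Real.log y - m|
      ≤ ∫ y in Icc a b, ((Real.log b - Real.log y) + (Real.log b - m)) := by
        refine setIntegral_mono_on (hlog.sub (hc m)).abs (((hc _).sub hlog).add (hc _))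
          measurableSet_Icc fun y hy => ?_
        have := hnonneg y hy
        rw [abs_le]
        constructor <;> linarith
    _ = 2 * ∫ y in Icc a b, (Real.log b - Real.log y) := by
        rw [integral_add (f := fun y => Real.log b - Real.log y) ((hc _).sub hlog) (hc _),
          setIntegral_const, hvol, hsub, smul_eq_mul]
        ring
    _ ≤ 2 * (b - a) := by linarith

open Set in
/-- On any subset of `(0, ∞)`, the `BMO` seminorm of `log` is at most `2`. -/
theorem bmoSemiR_log_le {Ω : Set ℝ} (hΩ : Ω ⊆ Ioi 0) (μ : ℝ≥0∞) :
    bmoSemiR Ω μ Real.log ≤ 2 := by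
  refine iSup_le fun x => iSup_le fun r => iSup_le fun hr => iSup_le fun _ => iSup_le fun hB => ?_
  rw [Real.closedBall_eq_Icc] at hB ⊢
  have hab : x - r < x + r := by linarith
  have ha : 0 < x - r := hΩ (hB (left_mem_Icc.2 hab.le))
  have hint : IntegrableOn (fun y => |Real.log y - ⨍ z in Icc (x - r) (x + r), Real.log z|)
      (Icc (x - r) (x + r)) :=
    ((Real.continuousOn_log.mono fun y hy => (ha.trans_le hy.1).ne').sub
      continuousOn_const).abs.integrableOn_Icc
  rw [← ofReal_integral_eq_lintegral_ofReal hint (Filter.Eventually.of_forall fun _ => abs_nonneg _),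
    Real.volume_Icc, mul_comm, ← div_eq_mul_inv]
  refine ENNReal.div_le_of_le_mul ?_
  rw [← ENNReal.ofReal_ofNat 2, ← ENNReal.ofReal_mul zero_le_two]
  exact ENNReal.ofReal_le_ofReal (integral_abs_log_sub_average_le ha hab)

open Set in
theorem integrableOn_log_Ioo_zero_one : IntegrableOn Real.log (Ioo (0 : ℝ) 1) :=
  ((intervalIntegrable_iff_integrableOn_Ioc_of_le zero_le_one).1
    intervalIntegral.intervalIntegrable_log').mono_set Ioo_subset_Ioc_self

open Set in
theorem integral_abs_log_Ioo_zero_one : ∫ x in Ioo (0 : ℝ) 1, |Real.log x| = 1 := by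
  have : ∫ x in Ioo (0 : ℝ) 1, |Real.log x| = ∫ x in Ioo (0 : ℝ) 1, -Real.log x :=
    setIntegral_congr_fun measurableSet_Ioo fun x hx =>
      abs_of_nonpos (Real.log_nonpos hx.1.le hx.2.le)
  rw [this, integral_neg, ← integral_Ioc_eq_integral_Ioo,
    ← intervalIntegral.integral_of_le zero_le_one, integral_log]
  simp

open Set in
/-- The boundary seminorm of `log` on `(0, 1)` is infinite at every scale. -/
theorem bSemiR_log_Ioo_zero_one {ν : ℝ≥0∞} (hν : 0 < ν) :
    bSemiR (Ioo (0 : ℝ) 1) ν Real.log = ⊤ := by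
  refine ENNReal.eq_top_of_forall_nnreal_le fun c => ?_
  obtain ⟨s, hs0, hsν⟩ := ENNReal.lt_iff_exists_nnreal_btwn.1 hν
  have hs : 0 < (s : ℝ) := by exact_mod_cast hs0
  set r : ℝ := min s (min (Real.exp (-c)) (1 / 2))
  have hr0 : 0 < r := by positivity
  have hrc : r ≤ Real.exp (-c) := (min_le_right _ _).trans (min_le_left _ _)
  have hr1 : r < 1 := by
    have : r ≤ 1 / 2 := (min_le_right _ _).trans (min_le_right _ _)
    linarith
  have hrν : ENNReal.ofReal r < ν := by
    refine lt_of_le_of_lt ?_ hsν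
    rw [← ENNReal.ofReal_coe_nnreal]
    exact ENNReal.ofReal_le_ofReal (min_le_left _ _)
  have h0 : (0 : ℝ) ∈ frontier (Ioo (0 : ℝ) 1) := by simp [frontier_Ioo zero_lt_one]
  unfold bSemiR
  refine le_iSup_of_le 0 <| le_iSup_of_le h0 <| le_iSup_of_le r <| le_iSup_of_le hr0 <|
    le_iSup_of_le hrν ?_
  have hsub : Ioo 0 r ⊆ Ioo (0 : ℝ) 1 ∩ closedBall 0 r := fun y hy =>
    ⟨⟨hy.1, hy.2.trans hr1⟩, by
      rw [mem_closedBall, Real.dist_eq, sub_zero, abs_of_pos hy.1]; exact hy.2.le⟩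
  have hlow : (c : ℝ≥0∞) * ENNReal.ofReal r
      ≤ ∫⁻ y in Ioo (0 : ℝ) 1 ∩ closedBall 0 r, ENNReal.ofReal |Real.log y| := by
    calc (c : ℝ≥0∞) * ENNReal.ofReal r = ∫⁻ _ in Ioo 0 r, (c : ℝ≥0∞) := by simp
      _ ≤ ∫⁻ y in Ioo 0 r, ENNReal.ofReal |Real.log y| := by
        refine setLIntegral_mono' measurableSet_Ioo fun y hy => ?_
        rw [← ENNReal.ofReal_coe_nnreal]
        refine ENNReal.ofReal_le_ofReal (le_trans ?_ (neg_le_abs _))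
        have := (Real.log_le_iff_le_exp hy.1).2 (hy.2.le.trans hrc)
        linarith
      _ ≤ _ := lintegral_mono_set hsub
  rw [mul_comm, ← div_eq_mul_inv]
  exact (ENNReal.le_div_iff_mul_le (Or.inl (by simpa using hr0)) (Or.inl ofReal_ne_top)).2 hlow

/-- The uniformly local norm is at most the `L¹` norm over any larger set. -/
theorem ulNormR_le_lintegral {S T : Set ℝ} (hST : S ⊆ T) (f : ℝ → ℝ) :
    ulNormR S f ≤ ∫⁻ y in T, ENNReal.ofReal |f y| :=
  iSup_le fun _ => lintegral_mono_set (Set.inter_subset_left.trans hST)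

/-- on `Ω = (0,1)`, the function `f = log` is integrable with
`∫₀¹ |log| = 1` and has finite `BMO^∞` seminorm, but `[f]_{b^ν} = ∞` for all `ν`.
Hence `f ∈ bmo^μ_ν((0,1)) \ BMO_b^{μ,ν}((0,1))`: the inclusion
`BMO_b^{μ,ν}(Ω) ⊆ bmo^μ_ν(Ω)` is strict in general, even for bounded `Ω`. -/
theorem log_in_bmo_not_in_BMOb :
    IntegrableOn Real.log (Set.Ioo (0:ℝ) 1) volume ∧
    (∫ x in Set.Ioo (0:ℝ) 1, |Real.log x|) = 1 ∧
    bmoSemiR (Set.Ioo (0:ℝ) 1) ⊤ Real.log < ⊤ ∧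
    (∀ ν : ℝ≥0∞, 0 < ν → bSemiR (Set.Ioo (0:ℝ) 1) ν Real.log = ⊤) ∧
    (∀ μ : ℝ≥0∞, 0 < μ → ∀ ν : ℝ, 0 < ν →
      (bmoSemiR (Set.Ioo (0:ℝ) 1) μ Real.log
          + ulNormR (tubR (Set.Ioo (0:ℝ) 1) (ENNReal.ofReal ν)) Real.log < ⊤ ∧
        bmoSemiR (Set.Ioo (0:ℝ) 1) μ Real.log
          + bSemiR (Set.Ioo (0:ℝ) 1) (ENNReal.ofReal ν) Real.log = ⊤)) := by
  have hbmo (μ : ℝ≥0∞) : bmoSemiR (Set.Ioo (0:ℝ) 1) μ Real.log < ⊤ :=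
    (bmoSemiR_log_le Set.Ioo_subset_Ioi_self μ).trans_lt ofNat_lt_top
  refine ⟨integrableOn_log_Ioo_zero_one, integral_abs_log_Ioo_zero_one, hbmo ⊤,
    fun ν hν => bSemiR_log_Ioo_zero_one hν, fun μ _ ν hν => ⟨?_, ?_⟩⟩
  · refine ENNReal.add_lt_top.2 ⟨hbmo μ, (ulNormR_le_lintegral (Set.sep_subset _ _) _).trans_lt ?_⟩
    rw [← ofReal_integral_eq_lintegral_ofReal integrableOn_log_Ioo_zero_one.abs
      (Filter.Eventually.of_forall fun _ => abs_nonneg _)]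
    exact ofReal_lt_top
  · rw [bSemiR_log_Ioo_zero_one (ENNReal.ofReal_pos.2 hν), add_top]
end
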